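/- Suppose the weighted composition operator uC_φ is invertible on the Dirichlet space, φ is a hyperbolic automorphism with attractive fixed point a and repulsive fixed point b on the unit circle, and u is in the disc algebra. Then the spectral radius of uC_φ on the Dirichlet space equals max{|u(a)|,|u(b)|}, and the spectrum is contained in the annulus {λ : min{|u(a)|,|u(b)|} ≤ |λ| ≤ max{|u(a)|,|u(b)|}}. -/

import Mathlib

open Complex Metric Set Filter MeasureTheory Finset

noncomputable section

/-- The open unit disc in ℂ. -/
def D1 : Set ℂ := Metric.ball 0 1

/-- Analytic (holomorphic) on the open unit disc. -/
def AnalyticOnD (f : ℂ → ℂ) : Prop := DifferentiableOn ℂ f D1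

/-- Bloch seminorm. -/
def blochSemi (f : ℂ → ℂ) : ℝ := ⨆ z : D1, (1 - ‖(z : ℂ)‖ ^ 2) * ‖deriv f (z : ℂ)‖

/-- Bloch norm. -/
def blochNorm (f : ℂ → ℂ) : ℝ := ‖f 0‖ + blochSemi f

/-- Membership in the Bloch space. -/
def InBloch (f : ℂ → ℂ) : Prop :=
  AnalyticOnD f ∧ ∃ C, ∀ z ∈ D1, (1 - ‖z‖ ^ 2) * ‖deriv f z‖ ≤ C

/-- Sup norm over the unit disc. -/
def supNormD (f : ℂ → ℂ) : ℝ := ⨆ z : D1, ‖f (z : ℂ)‖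

/-- Weighted composition operator uC_φ. -/
def wco (u φ : ℂ → ℂ) (f : ℂ → ℂ) : ℂ → ℂ := fun z => u z * f (φ z)

/-- Multiplication operator M_u. -/
def mult (u : ℂ → ℂ) (f : ℂ → ℂ) : ℂ → ℂ := fun z => u z * f z

/-- The weight u_{(n)} = ∏_{j=0}^{n-1} u ∘ φ_j. -/
def wprod (u φ : ℂ → ℂ) (n : ℕ) : ℂ → ℂ := fun z => ∏ j ∈ Finset.range n, u (φ^[j] z)

/-- Boundedness of an operator on the Bloch space. -/
def BddOnBloch (T : (ℂ → ℂ) → (ℂ → ℂ)) : Prop :=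
  ∃ C, ∀ f, InBloch f → InBloch (T f) ∧ blochNorm (T f) ≤ C * blochNorm f

/-- Operator norm on the Bloch space. -/
def opNormB (T : (ℂ → ℂ) → (ℂ → ℂ)) : ℝ :=
  sInf {C : ℝ | 0 ≤ C ∧ ∀ f, InBloch f → blochNorm (T f) ≤ C * blochNorm f}

/-- Invertibility of an operator on the Bloch space (bounded two-sided inverse). -/
def InvertibleOnBloch (T : (ℂ → ℂ) → (ℂ → ℂ)) : Prop :=
  BddOnBloch T ∧ ∃ S, BddOnBloch S ∧
    ∀ f, InBloch f → Set.EqOn (S (T f)) f D1 ∧ Set.EqOn (T (S f)) f D1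

/-- Spectrum of an operator acting on the Bloch space. -/
def blochSpectrum (T : (ℂ → ℂ) → (ℂ → ℂ)) : Set ℂ :=
  {lam | ¬ InvertibleOnBloch (fun f z => lam * f z - T f z)}

/-- Automorphism of the unit disc (Möbius form). -/
def IsDiscAuto (φ : ℂ → ℂ) : Prop :=
  ∃ lam a : ℂ, ‖lam‖ = 1 ∧ a ∈ D1 ∧ ∀ z, φ z = lam * (a - z) / (1 - (starRingEnd ℂ) a * z)

/-- Hyperbolic distance on the unit disc. -/
def hypDist (z w : ℂ) : ℝ :=
  (1 / 2) * Real.log ((1 + ‖(z - w) / (1 - (starRingEnd ℂ) z * w)‖) /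
    (1 - ‖(z - w) / (1 - (starRingEnd ℂ) z * w)‖))

/-- The disc algebra A(𝔻). -/
def InDiscAlgebra (u : ℂ → ℂ) : Prop :=
  ContinuousOn u (Metric.closedBall 0 1) ∧ AnalyticOnD u

/-- u is bounded away from zero on the unit disc. -/
def BoundedAwayFromZero (u : ℂ → ℂ) : Prop := ∃ δ > 0, ∀ z ∈ D1, δ ≤ ‖u z‖

/-- Parabolic automorphism with unique fixed point a on the unit circle (φ'(a)=1). -/
def IsParabolicAuto (φ : ℂ → ℂ) (a : ℂ) : Prop :=
  IsDiscAuto φ ∧ ‖a‖ = 1 ∧ φ a = a ∧ deriv φ a = 1 ∧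
    ∀ w, ‖w‖ ≤ 1 → φ w = w → w = a

/-- Hyperbolic automorphism with attractive fixed point a and repulsive fixed point b. -/
def IsHyperbolicAuto (φ : ℂ → ℂ) (a b : ℂ) : Prop :=
  IsDiscAuto φ ∧ ‖a‖ = 1 ∧ ‖b‖ = 1 ∧ a ≠ b ∧ φ a = a ∧ φ b = b ∧
    ∃ μ : ℝ, 0 < μ ∧ μ < 1 ∧ deriv φ a = (μ : ℂ)

/-- Square of the Dirichlet norm (normalized area measure on 𝔻). -/
def dirichletNormSq (f : ℂ → ℂ) : ℝ :=
  ‖f 0‖ ^ 2 + (1 / Real.pi) * ∫ z in D1, ‖deriv f z‖ ^ 2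

/-- Dirichlet norm. -/
def dirichletNorm (f : ℂ → ℂ) : ℝ := Real.sqrt (dirichletNormSq f)

/-- Membership in the Dirichlet space. -/
def InDirichlet (f : ℂ → ℂ) : Prop :=
  AnalyticOnD f ∧ MeasureTheory.IntegrableOn (fun z => ‖deriv f z‖ ^ 2) D1

/-- Boundedness of an operator on the Dirichlet space. -/
def BddOnDirichlet (T : (ℂ → ℂ) → (ℂ → ℂ)) : Prop :=
  ∃ C, ∀ f, InDirichlet f → InDirichlet (T f) ∧ dirichletNorm (T f) ≤ C * dirichletNorm f

/-- Operator norm on the Dirichlet space. -/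
def opNormDir (T : (ℂ → ℂ) → (ℂ → ℂ)) : ℝ :=
  sInf {C : ℝ | 0 ≤ C ∧ ∀ f, InDirichlet f → dirichletNorm (T f) ≤ C * dirichletNorm f}

/-- Invertibility of an operator on the Dirichlet space. -/
def InvertibleOnDirichlet (T : (ℂ → ℂ) → (ℂ → ℂ)) : Prop :=
  BddOnDirichlet T ∧ ∃ S, BddOnDirichlet S ∧
    ∀ f, InDirichlet f → Set.EqOn (S (T f)) f D1 ∧ Set.EqOn (T (S f)) f D1

/-- Spectrum of an operator on the Dirichlet space. -/
def dirichletSpectrum (T : (ℂ → ℂ) → (ℂ → ℂ)) : Set ℂ :=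
  {lam | ¬ InvertibleOnDirichlet (fun f z => lam * f z - T f z)}

/-- Operator norm of M_{u'} : B → H^∞_{v₁}. -/
def opNormBtoHv1 (u : ℂ → ℂ) : ℝ :=
  sInf {C : ℝ | 0 ≤ C ∧ ∀ f, InBloch f → ∀ z ∈ D1,
    (1 - ‖z‖ ^ 2) * ‖deriv u z * f z‖ ≤ C * blochNorm f}

/-- Operator norm of M_{u'} : 𝒟 → A². -/
def opNormDtoA2 (u : ℂ → ℂ) : ℝ :=
  sInf {C : ℝ | 0 ≤ C ∧ ∀ f, InDirichlet f →
    Real.sqrt ((1 / Real.pi) * ∫ z in D1, ‖deriv u z * f z‖ ^ 2) ≤ C * dirichletNorm f}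

/-- The logarithmic weight log(e/(1-|z|²)). -/
def logWeight (z : ℂ) : ℝ := Real.log (Real.exp 1 / (1 - ‖z‖ ^ 2))

/-- Characterization of multipliers of the Bloch space: u ∈ H^∞ and the log condition. -/
def MultBChar (u : ℂ → ℂ) : Prop :=
  (∃ M, ∀ z ∈ D1, ‖u z‖ ≤ M) ∧
  (∃ M, ∀ z ∈ D1, (1 - ‖z‖ ^ 2) * ‖deriv u z‖ * logWeight z ≤ M)

section Helpers
open scoped ENNReal NNReal Topology

structure DM (φ ψ : ℂ → ℂ) (a b : ℂ) (μ : ℝ) : Prop where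
  mu0 : 0 < μ
  mu1 : μ < 1
  hab : a ≠ b
  na : ‖a‖ = 1
  nb : ‖b‖ = 1
  maps : ∀ z ∈ D1, φ z ∈ D1
  maps' : ∀ z ∈ D1, ψ z ∈ D1
  inv1 : ∀ z ∈ D1, ψ (φ z) = z
  inv2 : ∀ z ∈ D1, φ (ψ z) = z
  diff : DifferentiableOn ℂ φ D1
  diff' : DifferentiableOn ℂ ψ D1
  rel : ∀ z ∈ D1, ‖φ z - a‖ * ‖z - b‖ = μ * ‖z - a‖ * ‖φ z - b‖

theorem DM.symm {φ ψ : ℂ → ℂ} {a b : ℂ} {μ : ℝ} (h : DM φ ψ a b μ) : DM ψ φ b a μ where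
  mu0 := h.mu0
  mu1 := h.mu1
  hab := h.hab.symm
  na := h.nb
  nb := h.na
  maps := h.maps'
  maps' := h.maps
  inv1 := h.inv2
  inv2 := h.inv1
  diff := h.diff'
  diff' := h.diff
  rel := fun z hz => by
    have := h.rel (ψ z) (h.maps' z hz)
    rw [h.inv2 z hz] at this
    linarith



theorem mob_ne {α z : ℂ} (hα : ‖α‖ < 1) (hz : ‖z‖ ≤ 1) : 1 - (starRingEnd ℂ) α * z ≠ 0 := by
  intro h
  have h1 : (starRingEnd ℂ) α * z = 1 := by linear_combination -h
  have h2 : ‖α‖ * ‖z‖ = 1 := by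
    have := congrArg norm h1
    simpa using this
  nlinarith [norm_nonneg α, norm_nonneg z]

theorem mob_normSq (lam α z : ℂ) (hl : ‖lam‖ = 1) (hα : ‖α‖ < 1) (hz : ‖z‖ ≤ 1) :
    1 - ‖lam * (α - z) / (1 - (starRingEnd ℂ) α * z)‖ ^ 2
      = (1 - ‖α‖ ^ 2) * (1 - ‖z‖ ^ 2) / ‖1 - (starRingEnd ℂ) α * z‖ ^ 2 := by
  have hne := mob_ne hα hz
  have hn : ‖1 - (starRingEnd ℂ) α * z‖ ≠ 0 := by simpa using hne
  rw [norm_div, norm_mul, hl, one_mul, div_pow, eq_div_iff (by positivity), sub_mul,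
    div_mul_cancel₀ _ (by positivity)]
  simp only [← Complex.normSq_eq_norm_sq, Complex.normSq_apply]
  simp
  ring

theorem mob_lt (lam α z : ℂ) (hl : ‖lam‖ = 1) (hα : ‖α‖ < 1) (hz : ‖z‖ < 1) :
    ‖lam * (α - z) / (1 - (starRingEnd ℂ) α * z)‖ < 1 := by
  have h := mob_normSq lam α z hl hα hz.le
  have hn : 0 < ‖1 - (starRingEnd ℂ) α * z‖ := by simpa using mob_ne hα hz.le
  have : 0 < (1 - ‖α‖ ^ 2) * (1 - ‖z‖ ^ 2) / ‖1 - (starRingEnd ℂ) α * z‖ ^ 2 := by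
    have := norm_nonneg α; have := norm_nonneg z
    have : 0 < 1 - ‖α‖ ^ 2 := by nlinarith
    have : 0 < 1 - ‖z‖ ^ 2 := by nlinarith
    positivity
  rw [← h] at this
  nlinarith [norm_nonneg (lam * (α - z) / (1 - (starRingEnd ℂ) α * z))]

theorem mob_le (lam α z : ℂ) (hl : ‖lam‖ = 1) (hα : ‖α‖ < 1) (hz : ‖z‖ ≤ 1) :
    ‖lam * (α - z) / (1 - (starRingEnd ℂ) α * z)‖ ≤ 1 := by
  have h := mob_normSq lam α z hl hα hz
  have : 0 ≤ (1 - ‖α‖ ^ 2) * (1 - ‖z‖ ^ 2) / ‖1 - (starRingEnd ℂ) α * z‖ ^ 2 := by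
    have := norm_nonneg α; have := norm_nonneg z
    have : 0 ≤ 1 - ‖α‖ ^ 2 := by nlinarith
    have : 0 ≤ 1 - ‖z‖ ^ 2 := by nlinarith
    positivity
  rw [← h] at this
  nlinarith [norm_nonneg (lam * (α - z) / (1 - (starRingEnd ℂ) α * z))]

theorem mob_inv (lam α z : ℂ) (hl : ‖lam‖ = 1) (hα : ‖α‖ < 1) (hz : ‖z‖ ≤ 1) :
    (starRingEnd ℂ) lam * (lam * α - lam * (α - z) / (1 - (starRingEnd ℂ) α * z)) /
      (1 - (starRingEnd ℂ) (lam * α) * (lam * (α - z) / (1 - (starRingEnd ℂ) α * z))) = z := by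
  have hne := mob_ne hα hz
  have hll : (starRingEnd ℂ) lam * lam = 1 := by
    rw [mul_comm, Complex.mul_conj, Complex.normSq_eq_norm_sq, hl]; simp
  have hne2 := mob_ne (α := lam * α) (by simpa [hl] using hα) (mob_le lam α z hl hα hz)
  rw [div_eq_iff hne2, map_mul]
  have hw : lam * (α - z) / (1 - (starRingEnd ℂ) α * z) * (1 - (starRingEnd ℂ) α * z)
      = lam * (α - z) := div_mul_cancel₀ _ hne
  generalize lam * (α - z) / (1 - (starRingEnd ℂ) α * z) = w at hw
  apply mul_right_cancel₀ hne
  linear_combination (-(starRingEnd ℂ) lam + z * (starRingEnd ℂ) lam * (starRingEnd ℂ) α) * hw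
    + z * (1 - (starRingEnd ℂ) α * z) * hll

theorem mob_diffAt (lam α z : ℂ) (hα : ‖α‖ < 1) (hz : ‖z‖ ≤ 1) :
    DifferentiableAt ℂ (fun z => lam * (α - z) / (1 - (starRingEnd ℂ) α * z)) z := by
  have hne := mob_ne hα hz
  fun_prop (disch := exact hne)

theorem auto_data {φ : ℂ → ℂ} {a b : ℂ} (hh : IsHyperbolicAuto φ a b) :
    ∃ ψ μ, DM φ ψ a b μ ∧ ContinuousAt φ a ∧ ContinuousAt φ b ∧ ContinuousAt ψ a ∧
      ContinuousAt ψ b ∧ ψ a = a ∧ ψ b = b := by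
  obtain ⟨⟨lam, α, hl, hα, hφ⟩, ha, hb, hab, hφa, hφb, μ, hμ0, hμ1, hμ⟩ := hh
  have hα : ‖α‖ < 1 := by simpa [D1] using hα
  obtain rfl : φ = fun z => lam * (α - z) / (1 - (starRingEnd ℂ) α * z) := funext hφ
  have hl' : ‖(starRingEnd ℂ) lam‖ = 1 := by simpa using hl
  have hα' : ‖lam * α‖ < 1 := by simpa [hl] using hα
  have hll : (starRingEnd ℂ) lam * lam = 1 := by
    rw [mul_comm, Complex.mul_conj, Complex.normSq_eq_norm_sq, hl]; simp
  have hne_a := mob_ne hα ha.le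
  have hne_b := mob_ne hα hb.le
  have i1 := fun z hz => mob_inv lam α z hl hα hz
  have i2 := fun z hz => mob_inv ((starRingEnd ℂ) lam) (lam * α) z hl' hα' hz
  simp only [← mul_assoc, hll, one_mul, Complex.conj_conj] at i2
  have key : ∀ z w, ‖z‖ ≤ 1 → ‖w‖ ≤ 1 →
      lam * (α - z) / (1 - (starRingEnd ℂ) α * z) - lam * (α - w) / (1 - (starRingEnd ℂ) α * w)
      = -lam * (1 - (starRingEnd ℂ) α * α) * (z - w) /
        ((1 - (starRingEnd ℂ) α * z) * (1 - (starRingEnd ℂ) α * w)) := by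
    intro z w hz hw
    rw [div_sub_div _ _ (mob_ne hα hz) (mob_ne hα hw)]
    congr 1
    ring
  have hd : deriv (fun z => lam * (α - z) / (1 - (starRingEnd ℂ) α * z)) a
      = -lam * (1 - (starRingEnd ℂ) α * α) / (1 - (starRingEnd ℂ) α * a) ^ 2 := by
    have h1 : HasDerivAt (fun z => lam * (α - z)) (lam * (-1)) a :=
      ((hasDerivAt_id a).const_sub α).const_mul lam
    have h2 : HasDerivAt (fun z => 1 - (starRingEnd ℂ) α * z) (-((starRingEnd ℂ) α * 1)) a :=
      ((hasDerivAt_id a).const_mul _).const_sub 1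
    refine (h1.div h2 hne_a).deriv.trans ?_
    congr 1
    ring
  have hk := key a b ha.le hb.le
  simp only at hφa hφb
  rw [hφa, hφb] at hk
  have hab' : a - b ≠ 0 := sub_ne_zero.2 hab
  have hk2 : (1 - (starRingEnd ℂ) α * a) * (1 - (starRingEnd ℂ) α * b) =
      -lam * (1 - (starRingEnd ℂ) α * α) := by
    rw [eq_div_iff (mul_ne_zero hne_a hne_b)] at hk
    exact mul_left_cancel₀ hab' (by linear_combination hk)
  rw [hd, ← hk2] at hμ
  have hμ2 : (1 - (starRingEnd ℂ) α * b) = μ * (1 - (starRingEnd ℂ) α * a) := by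
    rw [← hμ]; field_simp
  refine ⟨fun z => (starRingEnd ℂ) lam * (lam * α - z) / (1 - (starRingEnd ℂ) (lam * α) * z), μ,
    ⟨hμ0, hμ1, hab, ha, hb, ?_, ?_, ?_, ?_, ?_, ?_, ?_⟩, ?_, ?_, ?_, ?_, ?_, ?_⟩
  · intro z hz
    simp only [D1, mem_ball_zero_iff] at hz ⊢
    exact mob_lt _ _ _ hl hα hz
  · intro z hz
    simp only [D1, mem_ball_zero_iff] at hz ⊢
    exact mob_lt _ _ _ hl' hα' hz
  · intro z hz
    simp only [D1, mem_ball_zero_iff] at hz ⊢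
    exact i1 z hz.le
  · intro z hz
    simp only [D1, mem_ball_zero_iff] at hz ⊢
    have := i2 z hz.le
    simpa only [← mul_assoc, hll, one_mul] using this
  · intro z hz
    simp only [D1, mem_ball_zero_iff] at hz
    exact (mob_diffAt _ _ _ hα hz.le).differentiableWithinAt
  · intro z hz
    simp only [D1, mem_ball_zero_iff] at hz
    exact (mob_diffAt _ _ _ hα' hz.le).differentiableWithinAt
  · intro z hz
    simp only [D1, mem_ball_zero_iff] at hz
    have e1 := key z a hz.le ha.le
    have e2 := key z b hz.le hb.le
    rw [hφa] at e1
    rw [hφb] at e2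
    have hne := mob_ne hα hz.le
    have : (μ:ℂ) ≠ 0 := by exact_mod_cast hμ0.ne'
    have hg : (lam * (α - z) / (1 - (starRingEnd ℂ) α * z) - a) * (z - b) =
        μ * (z - a) * (lam * (α - z) / (1 - (starRingEnd ℂ) α * z) - b) := by
      rw [e1, e2, hμ2]
      field_simp
    have := congrArg norm hg
    rw [norm_mul, norm_mul, norm_mul] at this
    rw [this]
    simp [abs_of_pos hμ0]
  · exact (mob_diffAt _ _ _ hα ha.le).continuousAt
  · exact (mob_diffAt _ _ _ hα hb.le).continuousAt
  · exact (mob_diffAt _ _ _ hα' ha.le).continuousAt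
  · exact (mob_diffAt _ _ _ hα' hb.le).continuousAt
  · have := i1 a ha.le
    rwa [hφa] at this
  · have := i1 b hb.le
    rwa [hφb] at this


noncomputable def L2 (g : ℂ → ℂ) : ℝ≥0∞ := eLpNorm g 2 (volume.restrict D1)

noncomputable def QD (f : ℂ → ℂ) : ℝ≥0∞ := ‖f 0‖ₑ + L2 (deriv f)

def InD (f : ℂ → ℂ) : Prop := AnalyticOnD f ∧ QD f ≠ ⊤

theorem isOpen_D1 : IsOpen D1 := isOpen_ball
theorem meas_D1 : MeasurableSet D1 := isOpen_D1.measurableSet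
theorem zero_mem_D1 : (0:ℂ) ∈ D1 := by simp [D1]

theorem L2_eq (g : ℂ → ℂ) : L2 g = (∫⁻ z in D1, ‖g z‖ₑ ^ 2) ^ (1/2 : ℝ) := by
  rw [L2, eLpNorm_eq_lintegral_rpow_enorm_toReal (by simp) (by simp)]
  simp

theorem L2_sq (g : ℂ → ℂ) : (L2 g) ^ 2 = ∫⁻ z in D1, ‖g z‖ₑ ^ 2 := by
  rw [L2_eq, ← ENNReal.rpow_natCast, ← ENNReal.rpow_mul]
  simp

theorem L2_mono {f g : ℂ → ℂ} (h : ∀ z ∈ D1, ‖f z‖ ≤ ‖g z‖) : L2 f ≤ L2 g := by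
  apply eLpNorm_mono_ae
  exact (ae_restrict_iff' meas_D1).2 (ae_of_all _ h)

theorem L2_congr {f g : ℂ → ℂ} (h : ∀ z ∈ D1, f z = g z) : L2 f = L2 g :=
  le_antisymm (L2_mono fun z hz => by rw [h z hz]) (L2_mono fun z hz => by rw [h z hz])

theorem L2_le_mul {f g : ℂ → ℂ} (c : ℝ≥0) (h : ∀ z ∈ D1, ‖f z‖ ≤ c * ‖g z‖) :
    L2 f ≤ c * L2 g := by
  have := eLpNorm_le_nnreal_smul_eLpNorm_of_ae_le_mul (μ := volume.restrict D1) (f := f) (g := g)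
    (c := c) ((ae_restrict_iff' meas_D1).2 (ae_of_all _ h)) 2
  simpa [L2, ENNReal.smul_def] using this

theorem analytic_deriv {f : ℂ → ℂ} (hf : AnalyticOnD f) : AnalyticOnD (deriv f) :=
  DifferentiableOn.deriv hf isOpen_D1

theorem aesm_of_cont {f : ℂ → ℂ} (hf : ContinuousOn f D1) :
    AEStronglyMeasurable f (volume.restrict D1) := hf.aestronglyMeasurable meas_D1

theorem L2_add_le {f g : ℂ → ℂ} (hf : ContinuousOn f D1) (hg : ContinuousOn g D1) :
    L2 (fun z => f z + g z) ≤ L2 f + L2 g :=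
  eLpNorm_add_le (aesm_of_cont hf) (aesm_of_cont hg) (by norm_num)

theorem deriv_congr_D1 {f g : ℂ → ℂ} (h : EqOn f g D1) : EqOn (deriv f) (deriv g) D1 :=
  fun _ hz => Filter.EventuallyEq.deriv_eq (h.eventuallyEq_of_mem (isOpen_D1.mem_nhds hz))

theorem QD_congr {f g : ℂ → ℂ} (h : EqOn f g D1) : QD f = QD g := by
  unfold QD
  rw [h zero_mem_D1, L2_congr (deriv_congr_D1 h)]

theorem AnalyticOnD_congr {f g : ℂ → ℂ} (h : EqOn f g D1) (hg : AnalyticOnD g) :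
    AnalyticOnD f := DifferentiableOn.congr hg h

theorem InD_congr {f g : ℂ → ℂ} (h : EqOn f g D1) (hg : InD g) : InD f :=
  ⟨AnalyticOnD_congr h hg.1, by rw [QD_congr h]; exact hg.2⟩

/-- change of variables -/
theorem L2_comp {φ : ℂ → ℂ} (hd : DifferentiableOn ℂ φ D1) (hi : InjOn φ D1)
    (him : φ '' D1 = D1) (g : ℂ → ℂ) : L2 (fun z => deriv φ z * g (φ z)) = L2 g := by
  rw [L2_eq, L2_eq]
  congr 1
  conv_rhs => rw [← him]
  have hfd : ∀ x ∈ D1, HasFDerivWithinAt φ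
      (((ContinuousLinearMap.toSpanSingleton ℂ (deriv φ x)).restrictScalars ℝ)) D1 x := by
    intro x hx
    exact ((hd.differentiableAt (isOpen_D1.mem_nhds hx)).hasDerivAt.hasFDerivAt.restrictScalars
      ℝ).hasFDerivWithinAt
  rw [lintegral_image_eq_lintegral_abs_det_fderiv_mul volume meas_D1 hfd hi]
  refine setLIntegral_congr_fun meas_D1 fun z hz => ?_
  simp only [enorm_mul, mul_pow]
  congr 1
  have : ((ContinuousLinearMap.toSpanSingleton ℂ (deriv φ z)).restrictScalars ℝ).det
      = ‖deriv φ z‖ ^ 2 := by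
    rw [ContinuousLinearMap.det]
    have h2 : (((ContinuousLinearMap.toSpanSingleton ℂ (deriv φ z)).restrictScalars ℝ : ℂ →L[ℝ] ℂ) :
      ℂ →ₗ[ℝ] ℂ) = LinearMap.mulLeft ℝ (deriv φ z) := by
      ext; simp [mul_comm]
    rw [h2, ← LinearMap.det_toMatrix Complex.basisOneI, Matrix.det_fin_two]
    simp [LinearMap.toMatrix_apply, ← Complex.normSq_eq_norm_sq, Complex.normSq_apply]
  rw [this, abs_of_nonneg (by positivity), ENNReal.ofReal_pow (norm_nonneg _), ofReal_norm]


theorem submean_circle {G : ℂ → ℂ} {w : ℂ} {R s : ℝ} (hG : DifferentiableOn ℂ G (ball w R))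
    (hs0 : 0 < s) (hs : s < R) :
    ENNReal.ofReal (2 * Real.pi) * ‖G w‖ₑ ≤
      ∫⁻ θ in Ioo (-Real.pi) Real.pi, ‖G (circleMap w s θ)‖ₑ := by
  have h1 : Real.circleAverage G w s = G w := by
    apply DiffContOnCl.circleAverage
    rw [abs_of_pos hs0]
    exact hG.diffContOnCl_ball (closedBall_subset_ball hs)
  rw [Real.circleAverage_eq_integral_add (-Real.pi),
    intervalIntegral.integral_comp_add_right (fun θ => G (circleMap w s θ))] at h1
  have h2 : ∫ θ in (-Real.pi)..Real.pi, G (circleMap w s θ) = (2 * Real.pi) • G w := by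
    rw [← h1, smul_smul, mul_inv_cancel₀ (by positivity), one_smul]
    congr 1 <;> ring
  rw [intervalIntegral.integral_of_le (by linarith [Real.pi_pos]), integral_Ioc_eq_integral_Ioo] at h2
  calc ENNReal.ofReal (2 * Real.pi) * ‖G w‖ₑ = ‖(2 * Real.pi) • G w‖ₑ := by
        rw [enorm_smul, Real.enorm_eq_ofReal (by positivity)]
    _ ≤ _ := by rw [← h2]; exact enorm_integral_le_lintegral_enorm _

theorem submean_disc {G : ℂ → ℂ} {w : ℂ} {R : ℝ} (hR : 0 < R)
    (hG : DifferentiableOn ℂ G (ball w R)) :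
    ENNReal.ofReal (R / 2) * (ENNReal.ofReal (R / 2) * (ENNReal.ofReal (2 * Real.pi) * ‖G w‖ₑ)) ≤
      ∫⁻ z in ball w R, ‖G z‖ₑ := by
  have hm : Measurable ((ball w R).indicator G) := by
    classical
    rw [← Set.piecewise_eq_indicator]
    exact hG.continuousOn.measurable_piecewise continuousOn_const measurableSet_ball
  set F : ℂ → ℝ≥0∞ := fun z => ‖(ball w R).indicator G (w + z)‖ₑ with hF
  have hFm : Measurable F := (hm.comp (measurable_const_add w)).enorm
  have e1 : ∫⁻ z in ball w R, ‖G z‖ₑ = ∫⁻ z, F z := by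
    rw [hF, lintegral_add_left_eq_self (fun z => ‖(ball w R).indicator G z‖ₑ) w,
      ← lintegral_indicator measurableSet_ball]
    congr 1
    ext z
    by_cases hz : z ∈ ball w R <;> simp [hz]
  rw [e1, ← Complex.lintegral_comp_polarCoord_symm]
  change _ ≤ ∫⁻ p in Ioi (0:ℝ) ×ˢ Ioo (-Real.pi) Real.pi, _
  rw [Measure.volume_eq_prod, ← Measure.prod_restrict, lintegral_prod]
  swap
  · apply Measurable.aemeasurable
    simp only [Complex.polarCoord_symm_apply, smul_eq_mul]
    have : Measurable (fun p : ℝ × ℝ => (p.1 * (Real.cos p.2 + Real.sin p.2 * Complex.I) : ℂ)) := by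
      fun_prop
    exact (measurable_fst.ennreal_ofReal).mul (hFm.comp this)
  calc ENNReal.ofReal (R / 2) * (ENNReal.ofReal (R / 2) * (ENNReal.ofReal (2 * Real.pi) * ‖G w‖ₑ)) 
      = ∫⁻ s in Ioo (R/2) R, (ENNReal.ofReal (R / 2) * (ENNReal.ofReal (2 * Real.pi) * ‖G w‖ₑ)) := by
        rw [setLIntegral_const, Real.volume_Ioo, mul_comm]
        congr 2; ring
    _ ≤ ∫⁻ s in Ioo (R/2) R, ∫⁻ θ in Ioo (-Real.pi) Real.pi, 
          ENNReal.ofReal s • F (Complex.polarCoord.symm (s, θ)) := by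
        refine setLIntegral_mono' measurableSet_Ioo fun s hs => ?_
        simp only [smul_eq_mul]
        rw [lintegral_const_mul' _ _ ENNReal.ofReal_ne_top]
        refine mul_le_mul' (ENNReal.ofReal_le_ofReal hs.1.le) ?_
        refine (submean_circle hG (by linarith [hs.1]) hs.2).trans_eq ?_
        congr 1
        ext θ
        have : circleMap w s θ = w + Complex.polarCoord.symm (s, θ) := by
          simp [circleMap, Complex.exp_mul_I]
        have h2 : circleMap w s θ ∈ ball w R := by
          simp [mem_ball, dist_eq_norm, circleMap, abs_of_pos (show 0 < s by linarith [hs.1]), hs.2]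
        rw [hF]
        simp only
        rw [← this, indicator_of_mem h2]
    _ ≤ _ := by
        refine lintegral_mono_set ?_
        intro s hs
        exact lt_trans (by positivity) hs.1

theorem eval_aux {ρ : ℝ} (hρ : ρ < 1) : ∃ K : ℝ≥0, ∀ g, AnalyticOnD g → ∀ w, ‖w‖ ≤ ρ →
    ‖g w‖ₑ ≤ K * L2 g := by
  set R := 1 - ρ with hR
  have hR0 : 0 < R := by linarith
  set c : ℝ := R / 2 * (R / 2 * (2 * Real.pi)) with hc
  have hc0 : 0 < c := by positivity
  refine ⟨(Real.sqrt c⁻¹).toNNReal, fun g hg w hw => ?_⟩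
  have hb : ball w R ⊆ D1 := by
    intro z hz
    simp only [mem_ball, dist_eq_norm] at hz
    simp only [D1, mem_ball_zero_iff]
    calc ‖z‖ = ‖(z - w) + w‖ := by ring_nf
      _ ≤ ‖z - w‖ + ‖w‖ := norm_add_le _ _
      _ < 1 := by linarith
  have h := submean_disc (G := fun z => g z ^ 2) hR0 ((hg.mono hb).pow 2)
  have h2 : ∫⁻ z in ball w R, ‖g z ^ 2‖ₑ ≤ (L2 g) ^ 2 := by
    rw [L2_sq]
    simp only [enorm_pow]
    exact lintegral_mono_set hb
  replace h := h.trans h2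
  rw [← mul_assoc, ← mul_assoc, ← ENNReal.ofReal_mul (by positivity), ← ENNReal.ofReal_mul (by positivity),
    enorm_pow, mul_assoc, ← hc] at h
  have h3 : ‖g w‖ₑ ^ 2 ≤ (((Real.sqrt c⁻¹).toNNReal : ℝ≥0∞) * L2 g) ^ 2 := by
    rw [mul_pow]
    have : ((Real.sqrt c⁻¹).toNNReal : ℝ≥0∞) ^ 2 = ENNReal.ofReal c⁻¹ := by
      change ENNReal.ofReal _ ^ 2 = _
      rw [← ENNReal.ofReal_pow (by positivity), Real.sq_sqrt (by positivity)]
    rw [this]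
    calc ‖g w‖ₑ ^ 2 = ENNReal.ofReal c⁻¹ * (ENNReal.ofReal c * ‖g w‖ₑ ^ 2) := by
          rw [← mul_assoc, ← ENNReal.ofReal_mul (by positivity), inv_mul_cancel₀ hc0.ne']
          simp
      _ ≤ _ := by gcongr
  exact (ENNReal.pow_le_pow_left_iff (by norm_num)).1 h3

theorem eval_bound {ρ : ℝ} (hρ : ρ < 1) : ∃ K : ℝ≥0, ∀ f, AnalyticOnD f → ∀ w, ‖w‖ ≤ ρ →
    ‖f w‖ₑ ≤ ‖f 0‖ₑ + K * L2 (deriv f) := by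
  obtain ⟨K, hK⟩ := eval_aux hρ
  refine ⟨K + 1, fun f hf w hw => ?_⟩
  by_cases htop : L2 (deriv f) = ⊤
  · rw [htop, ENNReal.mul_top (by simp)]; simp
  have hsub : closedBall (0:ℂ) ρ ⊆ D1 := closedBall_subset_ball hρ
  set C : ℝ≥0 := K * (L2 (deriv f)).toNNReal with hC
  have hCe : (C : ℝ≥0∞) = K * L2 (deriv f) := by
    rw [hC, ENNReal.coe_mul, ENNReal.coe_toNNReal htop]
  have hd : ∀ x ∈ closedBall (0:ℂ) ρ, ‖deriv f x‖ ≤ C := by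
    intro x hx
    have := hK _ (analytic_deriv hf) x (by simpa using hx)
    rw [← hCe, enorm_le_coe] at this
    exact_mod_cast this
  have := (convex_closedBall (0:ℂ) ρ).norm_image_sub_le_of_norm_deriv_le
    (fun x hx => hf.differentiableAt (isOpen_D1.mem_nhds (hsub hx))) hd
    (x := 0) (y := w) (by simpa using (norm_nonneg w).trans hw) (by simpa using hw)
  have h2 : ‖f w - f 0‖ ≤ C := by
    refine this.trans ?_
    have : ‖w - 0‖ ≤ 1 := by simpa using hw.trans hρ.le
    exact mul_le_of_le_one_right C.2 this
  calc ‖f w‖ₑ = ‖f 0 + (f w - f 0)‖ₑ := by ring_nf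
    _ ≤ ‖f 0‖ₑ + ‖f w - f 0‖ₑ := enorm_add_le _ _
    _ ≤ ‖f 0‖ₑ + (C : ℝ≥0∞) := by
        gcongr
        rw [enorm_le_coe]; exact_mod_cast h2
    _ ≤ _ := by
        rw [hCe]; gcongr; simp

theorem eval_QD {ρ : ℝ} (hρ : ρ < 1) : ∃ K : ℝ≥0, ∀ f, AnalyticOnD f → ∀ w, ‖w‖ ≤ ρ →
    ‖f w‖ₑ ≤ K * QD f := by
  obtain ⟨K, hK⟩ := eval_bound hρ
  refine ⟨K + 1, fun f hf w hw => (hK f hf w hw).trans ?_⟩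
  rw [QD, mul_add, ENNReal.coe_add, ENNReal.coe_one]
  gcongr
  · exact le_mul_of_one_le_left' (by simp)
  · simp


def QBdd (T : (ℂ → ℂ) → (ℂ → ℂ)) : Prop :=
  ∃ K : ℝ≥0, ∀ f, InD f → AnalyticOnD (T f) ∧ QD (T f) ≤ K * QD f

theorem QBdd.inD {T : (ℂ → ℂ) → (ℂ → ℂ)} (hT : QBdd T) {f : ℂ → ℂ} (hf : InD f) : InD (T f) := by
  obtain ⟨K, hK⟩ := hT
  exact ⟨(hK f hf).1, ((hK f hf).2.trans_lt (ENNReal.mul_lt_top (by simp) hf.2.lt_top)).ne⟩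

section
variable {φ ψ : ℂ → ℂ} {a b : ℂ} {μ : ℝ}

theorem DM.injOn (h : DM φ ψ a b μ) : InjOn φ D1 := fun x hx y hy hxy => by
  rw [← h.inv1 x hx, ← h.inv1 y hy, hxy]

theorem DM.image (h : DM φ ψ a b μ) : φ '' D1 = D1 := by
  ext z
  constructor
  · rintro ⟨w, hw, rfl⟩; exact h.maps w hw
  · intro hz; exact ⟨ψ z, h.maps' z hz, h.inv2 z hz⟩

theorem DM.iter (h : DM φ ψ a b μ) (n : ℕ) : ∀ z ∈ D1, φ^[n] z ∈ D1 :=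
  fun _ hz => (show MapsTo φ D1 D1 from h.maps).iterate n hz

theorem DM.comp_an (h : DM φ ψ a b μ) {f : ℂ → ℂ} (hf : AnalyticOnD f) :
    AnalyticOnD (fun z => f (φ z)) := DifferentiableOn.comp hf h.diff h.maps

theorem DM.deriv_comp (h : DM φ ψ a b μ) {f : ℂ → ℂ} (hf : AnalyticOnD f) :
    ∀ z ∈ D1, deriv (fun z => f (φ z)) z = deriv φ z * deriv f (φ z) := by
  intro z hz
  have h1 := hf.differentiableAt (isOpen_D1.mem_nhds (h.maps z hz))
  have h2 := h.diff.differentiableAt (isOpen_D1.mem_nhds hz)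
  rw [mul_comm]
  exact (h1.hasDerivAt.comp z h2.hasDerivAt).deriv

theorem DM.L2_deriv_comp (h : DM φ ψ a b μ) {f : ℂ → ℂ} (hf : AnalyticOnD f) :
    L2 (deriv (fun z => f (φ z))) = L2 (deriv f) := by
  rw [L2_congr (h.deriv_comp hf)]
  exact L2_comp h.diff h.injOn h.image (deriv f)

theorem DM.iter_an (h : DM φ ψ a b μ) {f : ℂ → ℂ} (hf : AnalyticOnD f) (n : ℕ) :
    AnalyticOnD (fun z => f (φ^[n] z)) := by
  induction n with
  | zero => simpa using hf
  | succ n ih => simpa [Function.iterate_succ_apply] using h.comp_an ih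

theorem DM.iter_L2 (h : DM φ ψ a b μ) {f : ℂ → ℂ} (hf : AnalyticOnD f) (n : ℕ) :
    L2 (deriv (fun z => f (φ^[n] z))) = L2 (deriv f) := by
  induction n with
  | zero => simp
  | succ n ih => 
    rw [← ih]
    simpa [Function.iterate_succ_apply] using h.L2_deriv_comp (h.iter_an hf n)

theorem DM.iter_QD (h : DM φ ψ a b μ) : ∃ K : ℝ≥0, ∀ f, AnalyticOnD f → ∀ n : ℕ,
    QD (fun z => f (φ^[n] z)) ≤ K * ((n : ℝ≥0∞) + 1) * QD f := by
  have h0 : ‖φ 0‖ < 1 := by simpa [D1] using h.maps 0 zero_mem_D1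
  obtain ⟨K, hK⟩ := eval_bound h0
  have key : ∀ f, AnalyticOnD f → ∀ n : ℕ, ‖f (φ^[n] 0)‖ₑ ≤ ‖f 0‖ₑ + n * (K * L2 (deriv f)) := by
    intro f hf n
    induction n with
    | zero => simp
    | succ n ih =>
      have := hK _ (h.iter_an hf n) (φ 0) le_rfl
      rw [h.iter_L2 hf, ← Function.iterate_succ_apply] at this
      refine this.trans ?_
      push_cast
      rw [add_mul, one_mul, ← add_assoc]
      gcongr
  refine ⟨K + 1, fun f hf n => ?_⟩
  unfold QD
  rw [h.iter_L2 hf]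
  have e : ((K + 1 : ℝ≥0) : ℝ≥0∞) * ((n : ℝ≥0∞) + 1) * (‖f 0‖ₑ + L2 (deriv f)) = 
    (‖f 0‖ₑ + n * (K * L2 (deriv f)) + L2 (deriv f)) + (K * (n + 1) * ‖f 0‖ₑ + n * ‖f 0‖ₑ
      + K * L2 (deriv f) + n * L2 (deriv f)) := by push_cast; ring
  rw [e]
  exact (add_le_add_left (key f hf n) _).trans le_self_add

theorem DM.weight (h : DM φ ψ a b μ) {u : ℂ → ℂ} {r B δ : ℝ} (hr : 0 < r) (hδ : 0 < δ)
    (hB : ∀ z ∈ D1, ‖u z‖ ≤ B)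
    (hna : ∀ z ∈ D1, ‖z - a‖ < δ → ‖u z‖ ≤ r) (hnb : ∀ z ∈ D1, ‖z - b‖ < δ → ‖u z‖ ≤ r) :
    ∃ (V : ℂ → ℝ) (c0 C0 : ℝ≥0), 0 < c0 ∧ ContinuousOn V D1 ∧
      (∀ z ∈ D1, c0 ≤ V z ∧ V z ≤ C0) ∧ ∀ z ∈ D1, ‖u z‖ * V z ≤ r * V (φ z) := by
  have hμ0 := h.mu0
  have hμ1 := h.mu1
  have pos : ∀ z ∈ D1, ∀ c : ℂ, ‖c‖ = 1 → 0 < ‖z - c‖ ∧ ‖z - c‖ ≤ 2 := by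
    intro z hz c hc
    have hz : ‖z‖ < 1 := by simpa [D1] using hz
    constructor
    · rw [norm_pos_iff, sub_ne_zero]; rintro rfl; linarith
    · linarith [norm_sub_le z c]
  have hB0 : 0 ≤ B := (norm_nonneg _).trans (hB 0 zero_mem_D1)
  set c := δ / 2 with hc
  set C := 2 / δ with hC
  have hc0 : 0 < c := by positivity
  have hC0 : 0 < C := by positivity
  set s : ℂ → ℝ := fun z => ‖z - a‖ / ‖z - b‖ with hs
  have hsφ : ∀ z ∈ D1, s (φ z) = μ * s z := by
    intro z hz
    have h1 := (pos z hz b h.nb).1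
    have h2 := (pos _ (h.maps z hz) b h.nb).1
    simp only [hs]
    rw [mul_div_assoc', div_eq_div_iff h2.ne' h1.ne', h.rel z hz]
  obtain ⟨p, hp⟩ : ∃ p : ℕ, μ ^ p * B ≤ r := by
    have : Tendsto (fun p : ℕ => μ ^ p * B) atTop (𝓝 (0 * B)) :=
      (tendsto_pow_atTop_nhds_zero_of_lt_one hμ0.le hμ1).mul_const B
    rw [zero_mul] at this
    exact (this.eventually (ge_mem_nhds hr)).exists
  set cl : ℝ → ℝ := fun t => max (c * μ) (min C t) with hcl
  have clpos : ∀ t, 0 < cl t := fun t => lt_of_lt_of_le (by positivity) (le_max_left _ _)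
  have clmono : Monotone cl := fun x y hxy => by simp only [hcl]; gcongr
  refine ⟨fun z => ((cl (s z)) ^ p)⁻¹, (((max (c * μ) C) ^ p)⁻¹).toNNReal,
    (((c * μ) ^ p)⁻¹).toNNReal, ?_, ?_, ?_, ?_⟩
  · rw [Real.toNNReal_pos]; positivity
  · have hsc : ContinuousOn s D1 := by
      apply ContinuousOn.div (by fun_prop) (by fun_prop)
      intro z hz; exact (pos z hz b h.nb).1.ne'
    have : ContinuousOn (fun z => cl (s z)) D1 := by
      simp only [hcl]; fun_prop
    exact (this.pow p).inv₀ (fun z hz => (pow_pos (clpos _) p).ne')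
  · intro z hz
    have := clpos (s z)
    rw [Real.coe_toNNReal _ (by positivity), Real.coe_toNNReal _ (by positivity)]
    beta_reduce
    constructor
    · have h1 : cl (s z) ≤ max (c * μ) C := max_le_max le_rfl (min_le_left _ _)
      gcongr
    · have h1 : c * μ ≤ cl (s z) := le_max_left _ _
      gcongr
  · intro z hz
    have hp1 := pos z hz a h.na
    have hp2 := pos z hz b h.nb
    have ht : 0 < s z := div_pos hp1.1 hp2.1
    simp only
    rw [hsφ z hz]
    have c1 := clpos (s z)
    have c2 := clpos (μ * s z)
    have hmono : cl (μ * s z) ≤ cl (s z) := clmono (by nlinarith)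
    have hV : ((cl (s z)) ^ p)⁻¹ ≤ ((cl (μ * s z)) ^ p)⁻¹ := by gcongr
    by_cases h1 : s z < c
    · have : ‖u z‖ ≤ r := by
        apply hna z hz
        rw [hs, div_lt_iff₀ hp2.1] at h1
        calc ‖z - a‖ < c * ‖z - b‖ := h1
          _ ≤ c * 2 := by gcongr; exact hp2.2
          _ = δ := by rw [hc]; ring
      gcongr
    by_cases h2 : C < s z
    · have : ‖u z‖ ≤ r := by
        apply hnb z hz
        rw [hs, lt_div_iff₀ hp2.1] at h2
        have h3 : C * ‖z - b‖ < 2 := h2.trans_le hp1.2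
        rw [hC, div_mul_eq_mul_div, div_lt_iff₀ hδ] at h3
        linarith
      gcongr
    push Not at h1 h2
    have e1 : cl (s z) = s z := by
      simp only [hcl]; rw [min_eq_right h2, max_eq_right]; nlinarith
    have e2 : cl (μ * s z) = μ * s z := by
      simp only [hcl]; rw [min_eq_right (by nlinarith), max_eq_right]; nlinarith
    rw [e1, e2, mul_pow, mul_inv]
    have : ‖u z‖ ≤ r * (μ ^ p)⁻¹ := by
      rw [← div_eq_mul_inv, le_div_iff₀ (by positivity)]
      have := hB z hz
      have : 0 < μ ^ p := by positivity
      nlinarith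
    rw [← mul_assoc]
    gcongr

theorem DM.wco_an (h : DM φ ψ a b μ) {u f : ℂ → ℂ} (hu : AnalyticOnD u) (hf : AnalyticOnD f) :
    AnalyticOnD (wco u φ f) := DifferentiableOn.mul hu (h.comp_an hf)

theorem DM.wco_iter_an (h : DM φ ψ a b μ) {u f : ℂ → ℂ} (hu : AnalyticOnD u) (hf : AnalyticOnD f)
    (n : ℕ) : AnalyticOnD ((wco u φ)^[n] f) := by
  induction n with
  | zero => simpa using hf
  | succ n ih => rw [Function.iterate_succ_apply']; exact h.wco_an hu ih

theorem DM.wco_deriv (h : DM φ ψ a b μ) {u f : ℂ → ℂ} (hu : AnalyticOnD u) (hf : AnalyticOnD f) :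
    ∀ z ∈ D1, deriv (wco u φ f) z =
      u z * (deriv φ z * deriv f (φ z)) + deriv u z * f (φ z) := by
  intro z hz
  have h1 := hu.differentiableAt (isOpen_D1.mem_nhds hz)
  have h2 := (h.comp_an hf).differentiableAt (isOpen_D1.mem_nhds hz)
  have := (h1.hasDerivAt.mul h2.hasDerivAt).deriv
  rw [h.deriv_comp hf z hz] at this
  refine Eq.trans ?_ (this.trans ?_)
  · rfl
  · ring

theorem DM.mult_bound (h : DM φ ψ a b μ) {u : ℂ → ℂ} (hu : AnalyticOnD u) {B : ℝ}
    (hB : ∀ z ∈ D1, ‖u z‖ ≤ B) (hT : QBdd (wco u φ)) :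
    ∃ K : ℝ≥0, ∀ g, InD g → L2 (fun z => deriv u z * g (φ z)) ≤ K * QD g := by
  obtain ⟨K, hK⟩ := hT
  have hB0 : 0 ≤ B := (norm_nonneg _).trans (hB 0 zero_mem_D1)
  refine ⟨K + B.toNNReal, fun g hg => ?_⟩
  have h1 : L2 (fun z => deriv u z * g (φ z)) ≤ L2 (deriv (wco u φ g)) +
      L2 (fun z => - (u z * (deriv φ z * deriv g (φ z)))) := by
    rw [L2_congr (g := fun z => deriv (wco u φ g) z + - (u z * (deriv φ z * deriv g (φ z))))
      (fun z hz => by rw [h.wco_deriv hu hg.1 z hz]; ring)]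
    apply L2_add_le (analytic_deriv (h.wco_an hu hg.1)).continuousOn
    exact (DifferentiableOn.continuousOn (𝕜 := ℂ) ((hu.mul (DifferentiableOn.mul
      (analytic_deriv h.diff) (h.comp_an (analytic_deriv hg.1)))))).neg
  refine h1.trans ?_
  rw [ENNReal.coe_add, add_mul]
  gcongr
  · exact le_add_self.trans (hK g hg).2
  · have := L2_le_mul (f := fun z => - (u z * (deriv φ z * deriv g (φ z))))
      (g := fun z => deriv φ z * deriv g (φ z)) B.toNNReal (fun z hz => by
        rw [norm_neg, norm_mul, Real.coe_toNNReal _ hB0]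
        gcongr
        exact hB z hz)
    rw [L2_comp h.diff h.injOn h.image (deriv g)] at this
    refine this.trans ?_
    gcongr
    exact le_add_self

theorem DM.upper (h : DM φ ψ a b μ) {u : ℂ → ℂ} {B δ : ℝ} {r : ℝ≥0} (hr : 0 < r) (hδ : 0 < δ)
    (hu : AnalyticOnD u) (hB : ∀ z ∈ D1, ‖u z‖ ≤ B)
    (hna : ∀ z ∈ D1, ‖z - a‖ < δ → ‖u z‖ ≤ r) (hnb : ∀ z ∈ D1, ‖z - b‖ < δ → ‖u z‖ ≤ r)
    (hT : QBdd (wco u φ)) :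
    ∃ K : ℝ≥0, ∀ (n : ℕ) f, InD f →
      QD ((wco u φ)^[n] f) ≤ K * ((n : ℝ≥0∞) + 1) ^ 2 * r ^ n * QD f := by
  obtain ⟨V, c0, C0, hc0, hVc, hV, hVu⟩ := h.weight (by exact_mod_cast hr) hδ hB hna hnb
  obtain ⟨K1, hK1⟩ := h.mult_bound hu hB hT
  obtain ⟨K2, hK2⟩ := h.iter_QD
  have hV0 : ∀ z ∈ D1, 0 < V z := fun z hz => lt_of_lt_of_le (by exact_mod_cast hc0) (hV z hz).1
  have pt : ∀ f (n : ℕ), ∀ z ∈ D1, ‖(wco u φ)^[n] f z‖ * V z ≤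
      r ^ n * V (φ^[n] z) * ‖f (φ^[n] z)‖ := by
    intro f n
    induction n with
    | zero => intro z hz; simp [mul_comm]
    | succ n ih =>
      intro z hz
      rw [Function.iterate_succ_apply', Function.iterate_succ_apply, wco, norm_mul]
      have := ih (φ z) (h.maps z hz)
      calc ‖u z‖ * ‖(wco u φ)^[n] f (φ z)‖ * V z = (‖u z‖ * V z) * ‖(wco u φ)^[n] f (φ z)‖ := by ring
        _ ≤ (r * V (φ z)) * ‖(wco u φ)^[n] f (φ z)‖ :=
            mul_le_mul_of_nonneg_right (hVu z hz) (norm_nonneg _)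
        _ = r * (‖(wco u φ)^[n] f (φ z)‖ * V (φ z)) := by ring
        _ ≤ r * (r ^ n * V (φ^[n] (φ z)) * ‖f (φ^[n] (φ z))‖) := by gcongr
        _ = _ := by ring
  have pt2 : ∀ f (n : ℕ), ∀ z ∈ D1, ‖(wco u φ)^[n] f z‖ ≤
      ((C0 / c0 * r ^ n : ℝ≥0) : ℝ) * ‖f (φ^[n] z)‖ := by
    intro f n z hz
    have h1 := pt f n z hz
    have hc0' : (0:ℝ) < c0 := by exact_mod_cast hc0
    push_cast
    rw [div_mul_eq_mul_div, div_mul_eq_mul_div, le_div_iff₀ hc0']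
    calc ‖(wco u φ)^[n] f z‖ * c0 ≤ ‖(wco u φ)^[n] f z‖ * V z := by gcongr; exact (hV z hz).1
      _ ≤ _ := h1
      _ ≤ r ^ n * C0 * ‖f (φ^[n] z)‖ := by gcongr; exact (hV _ (h.iter n z hz)).2
      _ = _ := by ring
  set C1 : ℝ≥0 := C0 * (C0 / c0) * K1 * K2 with hC1
  set D : ℝ≥0 := C1 / r with hD
  have hDr : D * r = C1 := div_mul_cancel₀ _ hr.ne'
  have step : ∀ f, InD f → ∀ n : ℕ,
      L2 (fun z => (V z : ℂ) * deriv ((wco u φ)^[n + 1] f) z) ≤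
        r * L2 (fun z => (V z : ℂ) * deriv ((wco u φ)^[n] f) z) +
          C1 * r ^ n * ((n : ℝ≥0∞) + 1) * QD f := by
    intro f hf n
    rw [Function.iterate_succ_apply']
    have hg := h.wco_iter_an hu hf.1 n
    set g := (wco u φ)^[n] f with hgdef
    have hVc' : ContinuousOn (fun z => (V z : ℂ)) D1 := Complex.continuous_ofReal.comp_continuousOn hVc
    have h1 : L2 (fun z => (V z : ℂ) * deriv (wco u φ g) z) ≤
        L2 (fun z => (V z : ℂ) * (u z * (deriv φ z * deriv g (φ z)))) +
        L2 (fun z => (V z : ℂ) * (deriv u z * g (φ z))) := by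
      rw [L2_congr (g := fun z => (V z : ℂ) * (u z * (deriv φ z * deriv g (φ z))) +
        (V z : ℂ) * (deriv u z * g (φ z))) (fun z hz => by rw [h.wco_deriv hu hg z hz]; ring)]
      apply L2_add_le
      · exact hVc'.mul (hu.mul (DifferentiableOn.mul
          (analytic_deriv h.diff) (h.comp_an (analytic_deriv hg)))).continuousOn
      · exact hVc'.mul (DifferentiableOn.mul (analytic_deriv hu) (h.comp_an hg)).continuousOn
    refine h1.trans (add_le_add ?_ ?_)
    · rw [← L2_comp h.diff h.injOn h.image (fun z => (V z : ℂ) * deriv g z)]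
      apply L2_le_mul
      intro z hz
      have h2 := hVu z hz
      have h3 := hV0 z hz
      have h4 := hV0 _ (h.maps z hz)
      simp only [norm_mul, Complex.norm_real, Real.norm_eq_abs, abs_of_pos h3, abs_of_pos h4]
      calc V z * (‖u z‖ * (‖deriv φ z‖ * ‖deriv g (φ z)‖))
          = (‖u z‖ * V z) * (‖deriv φ z‖ * ‖deriv g (φ z)‖) := by ring
        _ ≤ (r * V (φ z)) * (‖deriv φ z‖ * ‖deriv g (φ z)‖) := by gcongr
        _ = _ := by ring
    · have hfn := h.iter_an hf.1 n
      have hfn' : InD (fun z => f (φ^[n] z)) := ⟨hfn, ((hK2 f hf.1 n).trans_lt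
        (ENNReal.mul_lt_top (by finiteness) hf.2.lt_top)).ne⟩
      have h2 : L2 (fun z => (V z : ℂ) * (deriv u z * g (φ z))) ≤
          (C0 * (C0 / c0 * r ^ n) : ℝ≥0) * L2 (fun z => deriv u z * f (φ^[n] (φ z))) := by
        apply L2_le_mul
        intro z hz
        have h3 := hV0 z hz
        have h5 := pt2 f n (φ z) (h.maps z hz)
        simp only [norm_mul, Complex.norm_real, Real.norm_eq_abs, abs_of_pos h3]
        calc V z * (‖deriv u z‖ * ‖g (φ z)‖) ≤ 
            C0 * (‖deriv u z‖ * (((C0 / c0 * r ^ n : ℝ≥0) : ℝ) * ‖f (φ^[n] (φ z))‖)) := by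
              gcongr
              exact (hV z hz).2
          _ = _ := by push_cast; ring
      have h6 := hK1 _ hfn'
      refine h2.trans ?_
      calc _ ≤ ((C0 * (C0 / c0 * r ^ n) : ℝ≥0) : ℝ≥0∞) * (K1 * (K2 * ((n : ℝ≥0∞) + 1) * QD f)) := by
            gcongr
            exact h6.trans (by gcongr; exact hK2 f hf.1 n)
        _ = _ := by rw [hC1]; push_cast; ring
  have main : ∀ f, InD f → ∀ n : ℕ,
      L2 (fun z => (V z : ℂ) * deriv ((wco u φ)^[n] f) z) ≤
        (C0 + D * n ^ 2) * r ^ n * QD f := by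
    intro f hf n
    induction n with
    | zero =>
      have := L2_le_mul (f := fun z => (V z : ℂ) * deriv f z) (g := deriv f) C0 (fun z hz => by
        rw [norm_mul, Complex.norm_real, Real.norm_eq_abs, abs_of_pos (hV0 z hz)]
        gcongr; exact (hV z hz).2)
      simp only [Function.iterate_zero, id_eq, pow_zero, mul_one]
      refine this.trans ?_
      gcongr
      · exact le_self_add
      · exact le_add_self
    | succ n ih =>
      refine (step f hf n).trans ?_
      have e : (C1 : ℝ≥0∞) = D * r := by rw [← ENNReal.coe_mul, hDr]
      calc _ ≤ r * ((C0 + D * n ^ 2) * r ^ n * QD f) + C1 * r ^ n * ((n : ℝ≥0∞) + 1) * QD f := by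
            gcongr
        _ ≤ r * ((C0 + D * n ^ 2) * r ^ n * QD f) + C1 * r ^ n * ((n : ℝ≥0∞) + 1) * QD f
            + D * r ^ (n+1) * n * QD f := le_self_add
        _ = _ := by rw [e]; push_cast; ring
  refine ⟨C0 / c0 * K2 + (C0 + D) / c0, fun n f hf => ?_⟩
  have v0 : ‖(wco u φ)^[n] f 0‖ₑ ≤ (C0 / c0 * r ^ n : ℝ≥0) * (K2 * ((n : ℝ≥0∞) + 1) * QD f) := by
    have h1 := pt2 f n 0 zero_mem_D1
    have h2 : ‖f (φ^[n] 0)‖ₑ ≤ QD (fun z => f (φ^[n] z)) := le_self_add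
    have h3 : ‖(wco u φ)^[n] f 0‖ₑ ≤ (C0 / c0 * r ^ n : ℝ≥0) * ‖f (φ^[n] 0)‖ₑ := by
      simp only [enorm_eq_nnnorm]
      exact_mod_cast h1
    refine h3.trans ?_
    gcongr
    exact h2.trans (hK2 f hf.1 n)
  have d0 : L2 (deriv ((wco u φ)^[n] f)) ≤ (c0⁻¹ : ℝ≥0) * ((C0 + D * n ^ 2) * r ^ n * QD f) := by
    refine (L2_le_mul (g := fun z => (V z : ℂ) * deriv ((wco u φ)^[n] f) z) c0⁻¹ ?_).trans ?_
    · intro z hz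
      rw [norm_mul, Complex.norm_real, Real.norm_eq_abs, abs_of_pos (hV0 z hz), ← mul_assoc]
      have hc0' : (0:ℝ) < c0 := by exact_mod_cast hc0
      refine le_mul_of_one_le_left (norm_nonneg _) ?_
      push_cast
      rw [inv_mul_eq_div, le_div_iff₀ hc0', one_mul]
      exact (hV z hz).1
    · gcongr
      exact main f hf n
  have n1 : (n : ℝ≥0∞) + 1 ≤ ((n : ℝ≥0∞) + 1) ^ 2 := le_self_pow₀ (by simp) (by norm_num)
  have n2 : (C0 + D * (n : ℝ≥0∞) ^ 2) ≤ ((C0 : ℝ≥0∞) + D) * ((n : ℝ≥0∞) + 1) ^ 2 := by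
    rw [add_mul]
    gcongr
    · exact le_mul_of_one_le_right' (one_le_pow₀ (by simp))
    · exact le_self_add
  calc QD ((wco u φ)^[n] f) ≤ _ := add_le_add v0 d0
    _ ≤ (C0 / c0 * r ^ n : ℝ≥0) * (K2 * ((n : ℝ≥0∞) + 1) ^ 2 * QD f) + 
      (c0⁻¹ : ℝ≥0) * ((((C0 : ℝ≥0∞) + D) * ((n : ℝ≥0∞) + 1) ^ 2) * r ^ n * QD f) := by gcongr
    _ = _ := by rw [div_eq_mul_inv, div_eq_mul_inv]; push_cast; ring

end


theorem sum_lemma {F : ℕ → ℂ → ℂ} (hF : ∀ n, AnalyticOnD (F n)) {K q : ℝ≥0} (hq : q < 1)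
    {X : ℝ≥0∞} (hX : X ≠ ⊤) (hb : ∀ n, QD (F n) ≤ K * q ^ n * X) :
    (∀ z ∈ D1, Summable fun n => F n z) ∧ AnalyticOnD (fun z => ∑' n, F n z) ∧
      QD (fun z => ∑' n, F n z) ≤ (2 * K * (1 - q)⁻¹ : ℝ≥0) * X := by
  have loc : ∀ ρ : ℝ, ρ < 1 → ∃ v : ℕ → ℝ, Summable v ∧ ∀ n, ∀ w ∈ ball (0:ℂ) ρ, ‖F n w‖ ≤ v n := by
    intro ρ hρ
    obtain ⟨K', hK'⟩ := eval_QD hρ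
    refine ⟨fun n => (K' * K * X.toNNReal : ℝ≥0) * (q:ℝ) ^ n, 
      (summable_geometric_of_lt_one q.2 (by exact_mod_cast hq)).mul_left _, fun n w hw => ?_⟩
    have h1 := hK' _ (hF n) w (by simpa using (mem_ball_zero_iff.1 hw).le)
    have h2 : ‖F n w‖ₑ ≤ (K' * K * X.toNNReal * q ^ n : ℝ≥0) := by
      calc _ ≤ K' * (K * q ^ n * X) := h1.trans (by gcongr; exact hb n)
        _ = _ := by push_cast; rw [ENNReal.coe_toNNReal hX]; ring
    rw [enorm_le_coe] at h2
    exact_mod_cast h2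
  have exρ : ∀ z ∈ D1, ∃ ρ < 1, z ∈ ball (0:ℂ) ρ := by
    intro z hz
    have hz : ‖z‖ < 1 := by simpa [D1] using hz
    exact ⟨(1 + ‖z‖) / 2, by linarith, by simp; linarith⟩
  have sub : ∀ ρ < 1, ball (0:ℂ) ρ ⊆ D1 := fun ρ hρ => ball_subset_ball hρ.le
  have geo : ∀ n, ∑ k ∈ range n, ((K:ℝ≥0∞) * q ^ k * X) ≤ (K * (1 - q)⁻¹ : ℝ≥0) * X := by
    intro n
    calc _ ≤ ∑' k, ((K:ℝ≥0∞) * q ^ k * X) := ENNReal.sum_le_tsum _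
      _ = _ := by
        rw [ENNReal.tsum_mul_right, ENNReal.tsum_mul_left, ENNReal.tsum_geometric]
        have : (1 - q) ≠ 0 := (tsub_pos_of_lt hq).ne'
        push_cast
        rw [ENNReal.coe_inv this]; push_cast; rfl
  refine ⟨?_, ?_, ?_⟩
  · intro z hz
    obtain ⟨ρ, hρ, hzρ⟩ := exρ z hz
    obtain ⟨v, hv, hv2⟩ := loc ρ hρ
    exact Summable.of_norm_bounded hv (fun n => hv2 n z hzρ)
  · intro z hz
    obtain ⟨ρ, hρ, hzρ⟩ := exρ z hz
    obtain ⟨v, hv, hv2⟩ := loc ρ hρ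
    exact ((differentiableOn_tsum_of_summable_norm hv (fun n => (hF n).mono (sub ρ hρ)) isOpen_ball
      hv2).differentiableAt (isOpen_ball.mem_nhds hzρ)).differentiableWithinAt
  · have hd : ∀ z ∈ D1, HasSum (fun n => deriv (F n) z) (deriv (fun w => ∑' n, F n w) z) := by
      intro z hz
      obtain ⟨ρ, hρ, hzρ⟩ := exρ z hz
      obtain ⟨v, hv, hv2⟩ := loc ρ hρ
      exact hasSum_deriv_of_summable_norm hv (fun n => (hF n).mono (sub ρ hρ)) isOpen_ball hv2 hzρ
    have hm : ∀ n, AEStronglyMeasurable (deriv (F n)) (volume.restrict D1) := fun n =>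
      aesm_of_cont (analytic_deriv (hF n)).continuousOn
    have h1 : L2 (deriv (fun w => ∑' n, F n w)) ≤ (K * (1 - q)⁻¹ : ℝ≥0) * X := by
      refine (Lp.eLpNorm_lim_le_liminf_eLpNorm (f := fun n => ∑ k ∈ range n, deriv (F k))
        (fun n => Finset.aestronglyMeasurable_sum _ (fun k _ => hm k)) _ ?_).trans ?_
      · refine (ae_restrict_iff' meas_D1).2 (ae_of_all _ fun z hz => ?_)
        simpa using (hd z hz).tendsto_sum_nat
      · refine liminf_le_of_le (by isBoundedDefault) fun b hb' => ?_
        obtain ⟨n, hn⟩ := hb'.exists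
        refine hn.trans ((eLpNorm_sum_le (fun k _ => hm k) (by norm_num)).trans ?_)
        refine le_trans ?_ (geo n)
        gcongr with k hk
        exact le_add_self.trans (hb k)
    have h0 : ‖∑' n, F n 0‖ₑ ≤ (K * (1 - q)⁻¹ : ℝ≥0) * X := by
      refine enorm_tsum_le_tsum_enorm.trans ?_
      rw [ENNReal.tsum_eq_iSup_nat]
      refine iSup_le fun n => le_trans ?_ (geo n)
      gcongr with k hk
      exact le_self_add.trans (hb k)
    refine (add_le_add h0 h1).trans_eq ?_
    push_cast; ring

theorem QD_const_mul (c : ℂ) (f : ℂ → ℂ) : QD (fun z => c * f z) = ‖c‖ₑ * QD f := by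
  unfold QD L2
  have : deriv (fun z => c * f z) = c • deriv f := by
    ext z; simp
  rw [this, eLpNorm_const_smul, enorm_mul, mul_add]

theorem QD_add_le {f g : ℂ → ℂ} (hf : AnalyticOnD f) (hg : AnalyticOnD g) :
    QD (fun z => f z + g z) ≤ QD f + QD g := by
  unfold QD
  have : L2 (deriv (fun z => f z + g z)) ≤ L2 (deriv f) + L2 (deriv g) := by
    rw [L2_congr (g := fun z => deriv f z + deriv g z) (fun z hz => deriv_fun_add
      (hf.differentiableAt (isOpen_D1.mem_nhds hz)) (hg.differentiableAt (isOpen_D1.mem_nhds hz)))]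
    exact L2_add_le (analytic_deriv hf).continuousOn (analytic_deriv hg).continuousOn
  calc _ ≤ (‖f 0‖ₑ + ‖g 0‖ₑ) + (L2 (deriv f) + L2 (deriv g)) := add_le_add (enorm_add_le _ _) this
    _ = _ := by ring

theorem wco_iter_lin (u φ f g : ℂ → ℂ) (c : ℂ) (n : ℕ) :
    (wco u φ)^[n] (fun z => f z - c * g z) = 
      fun z => (wco u φ)^[n] f z - c * (wco u φ)^[n] g z := by
  induction n with
  | zero => rfl
  | succ n ih =>
    simp only [Function.iterate_succ_apply', ih]
    ext z
    simp only [wco]; ring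

theorem DM.wco_iter_congr {φ ψ : ℂ → ℂ} {a b : ℂ} {μ : ℝ} (h : DM φ ψ a b μ) (u : ℂ → ℂ)
    {f g : ℂ → ℂ} (hfg : EqOn f g D1) (n : ℕ) :
    EqOn ((wco u φ)^[n] f) ((wco u φ)^[n] g) D1 := by
  induction n with
  | zero => exact hfg
  | succ n ih =>
    intro z hz
    simp only [Function.iterate_succ_apply', wco]
    rw [ih (h.maps z hz)]

theorem DM.neumann {φ ψ : ℂ → ℂ} {a b : ℂ} {μ : ℝ} (h : DM φ ψ a b μ) {u : ℂ → ℂ}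
    (hu : AnalyticOnD u) {K ρ : ℝ≥0} 
    (hK : ∀ (n : ℕ) f, InD f → QD ((wco u φ)^[n] f) ≤ K * ρ ^ n * QD f)
    {c : ℂ} (hc : ‖c‖₊ * ρ < 1) :
    ∃ N : (ℂ → ℂ) → (ℂ → ℂ), QBdd N ∧ 
      (∀ f, InD f → ∀ z ∈ D1, N f z - c * wco u φ (N f) z = f z) ∧
      (∀ f, InD f → ∀ z ∈ D1, N (fun z => f z - c * wco u φ f z) z = f z) ∧
      (∀ f g, EqOn f g D1 → EqOn (N f) (N g) D1) := by
  have hF : ∀ f, InD f → ∀ n, AnalyticOnD (fun z => c ^ n * (wco u φ)^[n] f z) := fun f hf n =>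
    (h.wco_iter_an hu hf.1 n).const_mul _
  have hb : ∀ f, InD f → ∀ n : ℕ, QD (fun z => c ^ n * (wco u φ)^[n] f z) ≤
      K * ((‖c‖₊ * ρ : ℝ≥0) : ℝ≥0∞) ^ n * QD f := by
    intro f hf n
    rw [QD_const_mul, enorm_pow]
    calc _ ≤ ‖c‖ₑ ^ n * (K * ρ ^ n * QD f) := by gcongr; exact hK n f hf
      _ = _ := by rw [ENNReal.coe_mul, enorm_eq_nnnorm]; ring
  have hs := fun f hf => sum_lemma (hF f hf) hc hf.2 (hb f hf)
  have rec1 : ∀ f, ∀ z, ∀ n : ℕ, c ^ (n+1) * (wco u φ)^[n+1] f z = 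
      c * u z * (c ^ n * (wco u φ)^[n] f (φ z)) := by
    intro f z n
    rw [Function.iterate_succ_apply', wco]; ring
  refine ⟨fun f z => ∑' n, c ^ n * (wco u φ)^[n] f z, ⟨_, fun f hf => (hs f hf).2⟩, ?_, ?_, ?_⟩
  · intro f hf z hz
    have h1 := (hs f hf).1 z hz
    beta_reduce
    rw [h1.tsum_eq_zero_add]
    simp only [rec1]
    rw [tsum_mul_left]
    simp [wco]; ring
  · intro f hf z hz
    have h1 := (hs f hf).1 z hz
    beta_reduce
    have e : ∀ n, c ^ n * (wco u φ)^[n] (fun z => f z - c * wco u φ f z) z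
        = c ^ n * (wco u φ)^[n] f z - c ^ (n+1) * (wco u φ)^[n+1] f z := by
      intro n
      rw [wco_iter_lin, Function.iterate_succ_apply]; ring
    simp only [e]
    rw [h1.tsum_sub ((summable_nat_add_iff 1).2 h1), h1.tsum_eq_zero_add]
    simp
  · intro f g hfg z hz
    beta_reduce
    congr 1
    ext n
    rw [h.wco_iter_congr u hfg n hz]

theorem mult_le {g : ℂ → ℂ} (hg : AnalyticOnD g) {C : ℝ≥0}
    (hC : ∀ f, InD f → QD (fun z => g z * f z) ≤ C * QD f) : ∀ z ∈ D1, ‖g z‖ ≤ C := by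
  have one : QD (fun _ => (1:ℂ)) = 1 := by
    unfold QD L2; simp
  have hp : ∀ n : ℕ, QD (fun z => g z ^ n) ≤ C ^ n := by
    intro n
    induction n with
    | zero => simp [one]
    | succ n ih =>
      have h1 : InD (fun z => g z ^ n) := ⟨hg.pow n, (ih.trans_lt (by finiteness)).ne⟩
      have := hC _ h1
      simp only [pow_succ']
      refine this.trans ?_
      gcongr
  intro z hz
  have hz : ‖z‖ < 1 := by simpa [D1] using hz
  obtain ⟨K, hK⟩ := eval_QD hz
  have h2 : ∀ n : ℕ, ‖g z‖ ^ n ≤ K * C ^ n := by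
    intro n
    have := (hK _ (hg.pow n) z le_rfl).trans (mul_le_mul_right (hp n) _)
    simp only [Pi.pow_apply, ← ENNReal.coe_pow, ← ENNReal.coe_mul, enorm_le_coe] at this
    have : ‖g z ^ n‖ ≤ ((K * C ^ n : ℝ≥0) : ℝ) := by exact_mod_cast this
    simpa using this
  by_contra hcon
  push Not at hcon
  rcases eq_or_ne C 0 with rfl | hC0
  · have := h2 1
    simp at this hcon
    exact hcon this
  have hC0 : (0:ℝ) < C := by exact_mod_cast pos_iff_ne_zero.2 hC0
  have h3 : 1 < ‖g z‖ / C := by rwa [one_lt_div hC0]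
  obtain ⟨n, hn⟩ := pow_unbounded_of_one_lt (K:ℝ) h3
  rw [div_pow, lt_div_iff₀ (by positivity)] at hn
  linarith [h2 n]


theorem inD_iff (f : ℂ → ℂ) : InDirichlet f ↔ InD f := by
  unfold InDirichlet InD
  refine and_congr_right fun hf => ?_
  have hm := aesm_of_cont (analytic_deriv hf).continuousOn
  rw [IntegrableOn, ← memLp_two_iff_integrable_sq_norm hm, MemLp, and_iff_right hm, QD, L2]
  simp [lt_top_iff_ne_top]

theorem dnorm_sq {f : ℂ → ℂ} (hf : InD f) :
    dirichletNormSq f = ‖f 0‖ ^ 2 + (1 / Real.pi) * (L2 (deriv f)).toReal ^ 2 := by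
  unfold dirichletNormSq
  congr 2
  have hm := aesm_of_cont (analytic_deriv hf.1).continuousOn
  have hm2 : AEStronglyMeasurable (fun z => ‖deriv f z‖ ^ 2) (volume.restrict D1) := hm.norm.pow 2
  rw [integral_eq_lintegral_of_nonneg_ae (ae_of_all _ fun z => by positivity) hm2, ← ENNReal.toReal_pow, L2_sq]
  congr 1
  apply lintegral_congr
  intro z
  rw [ENNReal.ofReal_pow (norm_nonneg _), ofReal_norm]

theorem QD_real {f : ℂ → ℂ} (hf : InD f) : (QD f).toReal = ‖f 0‖ + (L2 (deriv f)).toReal := by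
  have : L2 (deriv f) ≠ ⊤ := fun h => hf.2 (by rw [QD, h]; simp)
  rw [QD, ENNReal.toReal_add (by simp) this]; simp

theorem dnorm_le {f : ℂ → ℂ} (hf : InD f) : dirichletNorm f ≤ (QD f).toReal := by
  rw [QD_real hf, dirichletNorm, dnorm_sq hf]
  have h1 := norm_nonneg (f 0)
  have h2 : 0 ≤ (L2 (deriv f)).toReal := ENNReal.toReal_nonneg
  apply Real.sqrt_le_iff.2 ⟨by positivity, ?_⟩
  have : 1 / Real.pi ≤ 1 := by
    rw [div_le_one Real.pi_pos]; linarith [Real.pi_gt_three]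
  nlinarith [mul_nonneg h1 h2, sq_nonneg (L2 (deriv f)).toReal]

theorem le_dnorm {f : ℂ → ℂ} (hf : InD f) : (QD f).toReal ≤ 3 * dirichletNorm f := by
  rw [QD_real hf, dirichletNorm, dnorm_sq hf]
  set x := ‖f 0‖
  set y := (L2 (deriv f)).toReal
  have h1 : 0 ≤ x := norm_nonneg (f 0)
  have h2 : 0 ≤ y := ENNReal.toReal_nonneg
  have hp : y ^ 2 / 4 ≤ (1 / Real.pi) * y ^ 2 := by
    have : 1 / 4 ≤ 1 / Real.pi := one_div_le_one_div_of_le Real.pi_pos Real.pi_le_four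
    nlinarith [sq_nonneg y]
  have : (x + y) / 3 ≤ Real.sqrt (x ^ 2 + (1 / Real.pi) * y ^ 2) := by
    apply Real.le_sqrt_of_sq_le
    nlinarith [sq_nonneg (4 * x - y), sq_nonneg x, sq_nonneg y]
  linarith

theorem dnorm_nonneg (f : ℂ → ℂ) : 0 ≤ dirichletNorm f := Real.sqrt_nonneg _

/-- from Dirichlet norm bound to QD bound -/
theorem QD_of_dnorm {f g : ℂ → ℂ} (hf : InD f) (hg : InD g) {C : ℝ} (hC : 0 ≤ C)
    (h : dirichletNorm g ≤ C * dirichletNorm f) : QD g ≤ ((3 * C).toNNReal : ℝ≥0) * QD f := by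
  have : (QD g).toReal ≤ 3 * C * (QD f).toReal := by
    have := le_dnorm hg
    have := dnorm_le hf
    nlinarith [mul_le_mul_of_nonneg_left this hC]
  rw [← ENNReal.ofReal_toReal hg.2, ← ENNReal.ofReal_toReal hf.2]
  change _ ≤ ENNReal.ofReal (3 * C) * _
  rw [← ENNReal.ofReal_mul (by positivity)]
  exact ENNReal.ofReal_le_ofReal this

theorem dnorm_of_QD {f g : ℂ → ℂ} (hf : InD f) (hg : InD g) {K : ℝ≥0}
    (h : QD g ≤ K * QD f) : dirichletNorm g ≤ (3 * K) * dirichletNorm f := by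
  have h1 := dnorm_le hg
  have h2 := le_dnorm hf
  have h3 := ENNReal.toReal_mono (ENNReal.mul_ne_top (by simp) hf.2) h
  rw [ENNReal.toReal_mul] at h3
  simp only [ENNReal.coe_toReal] at h3
  nlinarith [mul_le_mul_of_nonneg_left h2 K.2]

theorem bdd_iff (T : (ℂ → ℂ) → (ℂ → ℂ)) : BddOnDirichlet T ↔ QBdd T := by
  constructor
  · rintro ⟨C, hC⟩
    refine ⟨(3 * max C 0).toNNReal, fun f hf => ?_⟩
    obtain ⟨h1, h2⟩ := hC f ((inD_iff f).2 hf)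
    rw [inD_iff] at h1
    exact ⟨h1.1, QD_of_dnorm hf h1 (le_max_right _ _) (h2.trans
      (mul_le_mul_of_nonneg_right (le_max_left _ _) (dnorm_nonneg f)))⟩
  · intro hT
    obtain ⟨K, hK⟩ := id hT
    refine ⟨3 * K, fun f hf => ?_⟩
    rw [inD_iff] at hf ⊢
    exact ⟨hT.inD hf, dnorm_of_QD hf (hT.inD hf) (hK f hf).2⟩

theorem poly_geom {r ρ : ℝ≥0} (hr : r < ρ) :
    ∃ C : ℝ≥0, ∀ n : ℕ, ((n : ℝ≥0) + 1) ^ 2 * r ^ n ≤ C * ρ ^ n := by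
  have hρ : 0 < ρ := lt_of_le_of_lt (zero_le) hr
  by_cases h0 : r = 0
  · refine ⟨1, fun n => ?_⟩
    rcases n with _ | n
    · simp
    · simp [h0]
  have hr0 : 0 < r := pos_iff_ne_zero.2 h0
  have hq : |(r / ρ : ℝ)| < 1 := by
    rw [abs_of_nonneg (by positivity), div_lt_one (by exact_mod_cast hρ)]; exact_mod_cast hr
  obtain ⟨C, hC⟩ := (tendsto_pow_const_mul_const_pow_of_abs_lt_one 2 hq).bddAbove_range
  refine ⟨(C * (ρ / r)).toNNReal, fun n => ?_⟩
  have h1 := hC ⟨n + 1, rfl⟩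
  rw [← NNReal.coe_le_coe]
  have h2 : (0:ℝ) < r := by exact_mod_cast hr0
  have h3 : (0:ℝ) < ρ := by exact_mod_cast hρ
  have : (((n:ℝ) + 1) ^ 2 * r ^ n) ≤ C * (ρ / r) * ρ ^ n := by
    simp only [Nat.cast_add, Nat.cast_one] at h1
    have e : (((n:ℝ) + 1) ^ 2 * r ^ n) = (((n:ℝ) + 1) ^ 2 * (r / ρ : ℝ) ^ (n + 1)) * (ρ / r * ρ ^ n) := by
      rw [div_pow]
      field_simp
      ring
    rw [e, mul_assoc C]
    exact mul_le_mul_of_nonneg_right h1 (by positivity)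
  push_cast
  refine this.trans ?_
  gcongr
  exact Real.le_coe_toNNReal _

theorem DM.upper2 {φ ψ : ℂ → ℂ} {a b : ℂ} {μ : ℝ} (h : DM φ ψ a b μ) {u : ℂ → ℂ} {B A A' : ℝ}
    (hu : AnalyticOnD u) (hB : ∀ z ∈ D1, ‖u z‖ ≤ B)
    (hta : Tendsto (fun z => ‖u z‖) (𝓝[D1] a) (𝓝 A))
    (htb : Tendsto (fun z => ‖u z‖) (𝓝[D1] b) (𝓝 A'))
    (hT : QBdd (wco u φ)) {ρ : ℝ≥0} (hρ : 0 < ρ) (hA : A < ρ) (hA' : A' < ρ) :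
    ∃ K : ℝ≥0, ∀ (n : ℕ) f, InD f → QD ((wco u φ)^[n] f) ≤ K * ρ ^ n * QD f := by
  obtain ⟨r, hr1, hr2⟩ := exists_between (max_lt (max_lt hA hA') (NNReal.coe_pos.2 hρ))
  have hr0 : 0 < r := (le_max_right _ _).trans_lt hr1
  have hrA : A < r := ((le_max_left _ _).trans (le_max_left _ _)).trans_lt hr1
  have hrA' : A' < r := ((le_max_right _ _).trans (le_max_left _ _)).trans_lt hr1
  lift r to ℝ≥0 using hr0.le
  have near : ∀ {c : ℂ} {X : ℝ}, Tendsto (fun z => ‖u z‖) (𝓝[D1] c) (𝓝 X) → X < r →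
      ∃ δ > 0, ∀ z ∈ D1, ‖z - c‖ < δ → ‖u z‖ ≤ r := by
    intro c X ht hX
    have := ht.eventually (eventually_le_nhds hX)
    obtain ⟨δ, hδ, hs⟩ := Metric.mem_nhdsWithin_iff.1 this
    exact ⟨δ, hδ, fun z hz hzc => hs ⟨by simpa [dist_eq_norm] using hzc, hz⟩⟩
  obtain ⟨δ1, hδ1, h1⟩ := near hta hrA
  obtain ⟨δ2, hδ2, h2⟩ := near htb hrA'
  obtain ⟨K, hK⟩ := h.upper (r := r) (by exact_mod_cast hr0) (lt_min hδ1 hδ2) hu hB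
    (fun z hz hd => h1 z hz (hd.trans_le (min_le_left _ _)))
    (fun z hz hd => h2 z hz (hd.trans_le (min_le_right _ _))) hT
  obtain ⟨C, hC⟩ := poly_geom (show r < ρ by exact_mod_cast hr2)
  refine ⟨K * C, fun n f hf => (hK n f hf).trans ?_⟩
  refine mul_le_mul_left ?_ _
  have : ((((n : ℝ≥0) + 1) ^ 2 * r ^ n : ℝ≥0) : ℝ≥0∞) ≤ ((C * ρ ^ n : ℝ≥0) : ℝ≥0∞) :=
    ENNReal.coe_le_coe.2 (hC n)
  push_cast at this ⊢
  rw [mul_assoc, mul_assoc]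
  gcongr


theorem root_lim {x : ℕ → ℝ} {M K : ℝ} (hM : 0 < M) (hK : 0 < K) (h0 : ∀ n, 0 ≤ x n)
    (h1 : ∀ n : ℕ, M ^ n ≤ K * (n + 1) * x n) (h2 : ∀ ρ > M, ∃ C, ∀ n : ℕ, x n ≤ C * ρ ^ n) :
    Tendsto (fun n : ℕ => x n ^ ((1:ℝ) / n)) atTop (𝓝 M) := by
  rw [tendsto_order]
  constructor
  · intro r' hr'
    obtain ⟨r, hr1, hr2⟩ := exists_between (max_lt hr' hM)
    have hr0 : 0 < r := (le_max_right _ _).trans_lt hr1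
    have hq : |r / M| < 1 := by rwa [abs_of_nonneg (by positivity), div_lt_one hM]
    have t1 := tendsto_pow_const_mul_const_pow_of_abs_lt_one 1 hq
    have t2 := tendsto_pow_const_mul_const_pow_of_abs_lt_one 0 hq
    have t3 := ((t1.add t2).const_mul K)
    simp only [add_zero, mul_zero] at t3
    filter_upwards [t3.eventually (gt_mem_nhds (zero_lt_one (α := ℝ))), eventually_ge_atTop 1]
      with n hn hn1
    have hlt : r ^ n < x n := by
      by_contra hcon
      have hcon := not_lt.1 hcon
      have e : K * (n + 1) * r ^ n < M ^ n := by
        rw [div_pow] at hn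
        have hp : 0 < M ^ n := by positivity
        have : K * (n + 1) * r ^ n / M ^ n < 1 := by
          refine lt_of_eq_of_lt ?_ hn
          simp; ring
        rwa [div_lt_one hp] at this
      have := h1 n
      have : K * (n + 1) * x n ≤ K * (n + 1) * r ^ n := by gcongr
      linarith
    have : (r ^ n) ^ ((1:ℝ) / n) < x n ^ ((1:ℝ) / n) :=
      Real.rpow_lt_rpow (by positivity) hlt (by positivity)
    rw [one_div, Real.pow_rpow_inv_natCast hr0.le (by omega)] at this
    rw [one_div]
    exact ((le_max_left _ _).trans_lt hr1).trans this
  · intro r hr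
    obtain ⟨ρ, hρ1, hρ2⟩ := exists_between hr
    obtain ⟨C, hC⟩ := h2 ρ hρ1
    have hρ0 : 0 < ρ := hM.trans hρ1
    have hr0 : 0 < r := hM.trans hr
    have t := (tendsto_pow_atTop_nhds_zero_of_lt_one (r := ρ / r) (by positivity)
      (by rwa [div_lt_one hr0])).const_mul C
    simp only [mul_zero] at t
    filter_upwards [t.eventually (gt_mem_nhds (zero_lt_one (α := ℝ))), eventually_ge_atTop 1]
      with n hn hn1
    have hlt : x n < r ^ n := by
      refine (hC n).trans_lt ?_
      rw [div_pow, ← mul_div_assoc, div_lt_one (by positivity)] at hn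
      exact hn
    have : x n ^ ((1:ℝ) / n) < (r ^ n) ^ ((1:ℝ) / n) :=
      Real.rpow_lt_rpow (h0 n) hlt (by positivity)
    rwa [one_div, Real.pow_rpow_inv_natCast hr0.le (by omega), ← one_div] at this

theorem wco_iter (u φ f : ℂ → ℂ) (n : ℕ) (z : ℂ) :
    (wco u φ)^[n] f z = wprod u φ n z * f (φ^[n] z) := by
  induction n generalizing f with
  | zero => simp [wprod]
  | succ n ih =>
    rw [Function.iterate_succ_apply, ih, wprod, wprod, Finset.prod_range_succ,
      Function.iterate_succ_apply', wco]
    ring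

theorem InD_one : InD (fun _ => (1:ℂ)) := by
  refine ⟨differentiableOn_const _, ?_⟩
  unfold QD L2; simp

section
variable {φ ψ : ℂ → ℂ} {a b : ℂ} {μ : ℝ}

theorem DM.comp_inD (h : DM φ ψ a b μ) {f : ℂ → ℂ} (hf : InD f) (n : ℕ) :
    InD (fun z => f (φ^[n] z)) := by
  obtain ⟨K, hK⟩ := h.iter_QD
  refine ⟨h.iter_an hf.1 n, ((hK f hf.1 n).trans_lt (ENNReal.mul_lt_top ?_ hf.2.lt_top)).ne⟩
  exact ENNReal.mul_lt_top (by simp) (by simp)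

theorem DM.inv_iter (h : DM φ ψ a b μ) (n : ℕ) : ∀ z ∈ D1, ψ^[n] (φ^[n] z) = z := by
  induction n with
  | zero => simp
  | succ n ih =>
    intro z hz
    rw [Function.iterate_succ_apply, Function.iterate_succ_apply', h.inv1 _ (h.iter n z hz), ih z hz]

theorem DM.inverse (h : DM φ ψ a b μ) {u : ℂ → ℂ} (hu : AnalyticOnD u)
    {S : (ℂ → ℂ) → (ℂ → ℂ)} (hS : QBdd S) (hTS : ∀ f, InD f → EqOn (wco u φ (S f)) f D1) :
    (∀ z ∈ D1, u z ≠ 0) ∧ AnalyticOnD (fun z => (u (ψ z))⁻¹) ∧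
      QBdd (wco (fun z => (u (ψ z))⁻¹) ψ) ∧ ∃ C : ℝ≥0, ∀ z ∈ D1, ‖(u (ψ z))⁻¹‖ ≤ C := by
  have hne : ∀ z ∈ D1, u z ≠ 0 := by
    intro z hz h0
    have := hTS _ InD_one hz
    simp [wco, h0] at this
  have han : AnalyticOnD (fun z => (u (ψ z))⁻¹) :=
    DifferentiableOn.inv (h.symm.comp_an hu) fun z hz => hne _ (h.maps' z hz)
  have hSR : ∀ f, InD f → EqOn (wco (fun z => (u (ψ z))⁻¹) ψ f) (S f) D1 := by
    intro f hf z hz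
    have := hTS f hf (h.maps' z hz)
    have h0 := hne _ (h.maps' z hz)
    simp only [wco, h.inv2 z hz] at this ⊢
    rw [← this]
    field_simp
  obtain ⟨K, hK⟩ := id hS
  refine ⟨hne, han, ⟨K, fun f hf => ⟨h.symm.wco_an han hf.1, ?_⟩⟩, ?_⟩
  · rw [QD_congr (hSR f hf)]; exact (hK f hf).2
  · obtain ⟨K', hK'⟩ := h.iter_QD
    refine ⟨K * (K' * 2), mult_le han fun f hf => ?_⟩
    have hf' := h.comp_inD hf 1
    have e : EqOn (fun z => (u (ψ z))⁻¹ * f z) (S (fun z => f (φ^[1] z))) D1 := by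
      intro z hz
      rw [← hSR _ hf' hz]
      simp [wco, h.inv2 z hz]
    rw [QD_congr e]
    refine (hK _ hf').2.trans ?_
    have := hK' f hf.1 1
    push_cast
    rw [mul_assoc]
    gcongr
    refine this.trans (le_of_eq ?_)
    norm_num

theorem neBot_D1 {c : ℂ} (hc : ‖c‖ = 1) : (𝓝[D1] c).NeBot := by
  rw [← mem_closure_iff_nhdsWithin_neBot, D1, closure_ball _ one_ne_zero]
  simp [hc]

theorem DM.wprod_lim (h : DM φ ψ a b μ) {u : ℂ → ℂ} {c : ℂ}
    (hu : Tendsto u (𝓝[D1] c) (𝓝 (u c))) (hc : ContinuousAt φ c) (hfix : φ c = c) (n : ℕ) :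
    Tendsto (fun z => ‖wprod u φ n z‖) (𝓝[D1] c) (𝓝 (‖u c‖ ^ n)) := by
  have ht : Tendsto φ (𝓝[D1] c) (𝓝[D1] c) := by
    apply tendsto_nhdsWithin_of_tendsto_nhds_of_eventually_within
    · have := hc.tendsto
      rw [hfix] at this
      exact this.mono_left nhdsWithin_le_nhds
    · exact eventually_mem_nhdsWithin.mono fun z hz => h.maps z hz
  have : Tendsto (wprod u φ n) (𝓝[D1] c) (𝓝 (∏ j ∈ Finset.range n, u c)) :=
    tendsto_finsetProd _ fun j _ => hu.comp (ht.iterate j)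
  simpa using this.norm

theorem DM.lower (h : DM φ ψ a b μ) {u : ℂ → ℂ} (hu : AnalyticOnD u) (hT : QBdd (wco u φ)) :
    ∃ K : ℝ, 0 < K ∧ ∀ c : ℂ, ‖c‖ = 1 → Tendsto u (𝓝[D1] c) (𝓝 (u c)) → ContinuousAt φ c → φ c = c →
      ∀ (n : ℕ) (C : ℝ), 0 ≤ C →
      (∀ f, InDirichlet f → dirichletNorm ((wco u φ)^[n] f) ≤ C * dirichletNorm f) →
      ‖u c‖ ^ n ≤ K * (n + 1) * C := by
  obtain ⟨K, hK⟩ := h.symm.iter_QD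
  have hTn : ∀ (n : ℕ) f, InD f → InD ((wco u φ)^[n] f) := by
    intro n f hf
    induction n with
    | zero => exact hf
    | succ n ih => rw [Function.iterate_succ_apply']; exact hT.inD ih
  refine ⟨3 * K + 1, by positivity, fun c hc huc hφ hfix n C hC hb => ?_⟩
  have hw : AnalyticOnD (wprod u φ n) := by
    have := h.wco_iter_an hu InD_one.1 n
    refine AnalyticOnD_congr (fun z hz => ?_) this
    simp [wco_iter]
  have key := mult_le hw (C := (3 * C).toNNReal * (K * (n + 1))) (fun f hf => by
    have hf' := h.symm.comp_inD hf n
    have e : EqOn (fun z => wprod u φ n z * f z) ((wco u φ)^[n] (fun z => f (ψ^[n] z))) D1 := by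
      intro z hz
      simp [wco_iter, h.inv_iter n z hz]
    rw [QD_congr e]
    refine (QD_of_dnorm hf' (hTn n _ hf') hC (hb _ ((inD_iff _).2 hf'))).trans ?_
    rw [ENNReal.coe_mul, mul_assoc]
    gcongr
    simpa using hK f hf.1 n)
  have := neBot_D1 hc
  have := le_of_tendsto (h.wprod_lim huc hφ hfix n) (eventually_mem_nhdsWithin.mono fun z hz => key z hz)
  refine this.trans ?_
  push_cast
  rw [Real.coe_toNNReal _ (by positivity)]
  nlinarith [mul_nonneg (Nat.cast_nonneg (α := ℝ) n) hC]

theorem QBdd.sub {T : (ℂ → ℂ) → (ℂ → ℂ)} (hT : QBdd T) (c d : ℂ) :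
    QBdd (fun f z => c * f z + d * T f z) := by
  obtain ⟨K, hK⟩ := hT
  refine ⟨‖c‖₊ + ‖d‖₊ * K, fun f hf => ?_⟩
  have h1 : AnalyticOnD (fun z => c * f z) := DifferentiableOn.const_mul hf.1 c
  have h2 : AnalyticOnD (fun z => d * T f z) := DifferentiableOn.const_mul (hK f hf).1 d
  refine ⟨DifferentiableOn.add h1 h2, (QD_add_le h1 h2).trans ?_⟩
  rw [QD_const_mul, QD_const_mul]
  push_cast
  rw [add_mul, mul_assoc]
  gcongr
  · exact le_of_eq rfl
  · exact le_of_eq rfl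
  · exact (hK f hf).2

theorem QBdd.comp {S T : (ℂ → ℂ) → (ℂ → ℂ)} (hS : QBdd S) (hT : QBdd T) :
    QBdd (fun f => S (T f)) := by
  obtain ⟨K, hK⟩ := id hS
  obtain ⟨K', hK'⟩ := id hT
  refine ⟨K * K', fun f hf => ⟨(hK _ (hT.inD hf)).1, (hK _ (hT.inD hf)).2.trans ?_⟩⟩
  push_cast
  rw [mul_assoc]
  gcongr
  exact (hK' f hf).2

theorem QBdd.smul {T : (ℂ → ℂ) → (ℂ → ℂ)} (hT : QBdd T) (d : ℂ) :
    QBdd (fun f z => d * T f z) := by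
  simpa using hT.sub 0 d

theorem DM.inv_large (h : DM φ ψ a b μ) {u : ℂ → ℂ} (hu : AnalyticOnD u) (hT : QBdd (wco u φ))
    {K ρ : ℝ≥0} (hK : ∀ (n : ℕ) f, InD f → QD ((wco u φ)^[n] f) ≤ K * ρ ^ n * QD f)
    {lam : ℂ} (hl : ρ < ‖lam‖₊) : InvertibleOnDirichlet (fun f z => lam * f z - wco u φ f z) := by
  have hl0 : lam ≠ 0 := by rintro rfl; simp at hl
  obtain ⟨N, hN, h1, h2, h3⟩ := h.neumann hu hK (c := lam⁻¹) (by
    rw [nnnorm_inv, inv_mul_lt_iff₀ (nnnorm_pos.2 hl0)]; simpa using hl)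
  refine ⟨(bdd_iff _).2 (by simpa [sub_eq_add_neg] using hT.sub lam (-1)),
    fun f z => lam⁻¹ * N f z, (bdd_iff _).2 (hN.smul _), fun f hf => ?_⟩
  rw [inD_iff] at hf
  constructor
  · intro z hz
    have hf' : InD (fun z => lam * f z) :=
      ⟨DifferentiableOn.const_mul hf.1 _, by
        rw [QD_const_mul]; exact ENNReal.mul_ne_top (by simp) hf.2⟩
    have e : EqOn (fun z => lam * f z - wco u φ f z)
        (fun z => lam * f z - lam⁻¹ * wco u φ (fun z => lam * f z) z) D1 := by
      intro z hz
      simp only [wco]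
      field_simp
    have := h3 _ _ e hz
    simp only
    rw [this, h2 _ hf' z hz]
    field_simp
  · intro z hz
    have := h1 f hf z hz
    simp only [wco] at this ⊢
    rw [← this]
    field_simp

theorem DM.inv_small (h : DM φ ψ a b μ) {u v : ℂ → ℂ} (hv : AnalyticOnD v)
    (hT : QBdd (wco u φ)) (hR : QBdd (wco v ψ)) (huv : ∀ z ∈ D1, u z * v (φ z) = 1)
    {K ρ : ℝ≥0} (hK : ∀ (n : ℕ) f, InD f → QD ((wco v ψ)^[n] f) ≤ K * ρ ^ n * QD f)
    {lam : ℂ} (hl : ‖lam‖₊ * ρ < 1) :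
    InvertibleOnDirichlet (fun f z => lam * f z - wco u φ f z) := by
  obtain ⟨N, hN, h1, h2, h3⟩ := h.symm.neumann hv hK hl
  refine ⟨(bdd_iff _).2 (by simpa [sub_eq_add_neg] using hT.sub lam (-1)),
    fun f z => (-1) * N (wco v ψ f) z, (bdd_iff _).2 ((hN.comp hR).smul _), fun f hf => ?_⟩
  rw [inD_iff] at hf
  have huv' : ∀ z ∈ D1, v z * u (ψ z) = 1 := by
    intro z hz
    have := huv _ (h.maps' z hz)
    rwa [h.inv2 z hz, mul_comm] at this
  constructor
  · intro z hz
    have hf' : InD (fun z => -1 * f z) :=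
      ⟨DifferentiableOn.const_mul hf.1 _, by
        rw [QD_const_mul]; exact ENNReal.mul_ne_top (by simp) hf.2⟩
    have e : EqOn (wco v ψ (fun z => lam * f z - wco u φ f z))
        (fun z => -1 * f z - lam * wco v ψ (fun z => -1 * f z) z) D1 := by
      intro z hz
      simp only [wco, h.inv2 z hz]
      linear_combination (-f z) * huv' z hz
    have := h3 _ _ e hz
    simp only
    rw [this, h2 _ hf' z hz]
    ring
  · intro z hz
    have := h1 _ (hR.inD hf) _ (h.maps z hz)
    simp only [wco, h.inv1 z hz] at this ⊢
    linear_combination (u z) * this + (f z + lam * N (wco v ψ f) z) * huv z hz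
end


theorem main_thm (u φ : ℂ → ℂ) (a b : ℂ) (hu : InDiscAlgebra u)
    (hh : IsHyperbolicAuto φ a b) (hinv : InvertibleOnDirichlet (wco u φ)) :
    Filter.Tendsto (fun n : ℕ => opNormDir ((wco u φ)^[n]) ^ ((1 : ℝ) / n))
        Filter.atTop (nhds (max ‖u a‖ ‖u b‖)) ∧
      dirichletSpectrum (wco u φ) ⊆
        {lam : ℂ | min ‖u a‖ ‖u b‖ ≤ ‖lam‖ ∧ ‖lam‖ ≤ max ‖u a‖ ‖u b‖} := by
  obtain ⟨ψ, μ, h, cφa, cφb, cψa, cψb, ψa, ψb⟩ := auto_data hh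
  obtain ⟨-, na, nb, -, φa, φb, -⟩ := hh
  obtain ⟨hT, S, hS, hST⟩ := hinv
  rw [bdd_iff] at hT hS
  have hTS : ∀ f, InD f → EqOn (wco u φ (S f)) f D1 := fun f hf => (hST f ((inD_iff f).2 hf)).2
  obtain ⟨hne, han, hR, C, hC⟩ := h.inverse hu.2 hS hTS
  obtain ⟨B, hB⟩ := (isCompact_closedBall (0:ℂ) 1).exists_bound_of_continuousOn hu.1
  have hB' : ∀ z ∈ D1, ‖u z‖ ≤ B := fun z hz => hB z (ball_subset_closedBall hz)
  have tu : ∀ c : ℂ, ‖c‖ = 1 → Tendsto u (𝓝[D1] c) (𝓝 (u c)) := fun c hc =>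
    (hu.1 c (by simp [hc])).mono_left (nhdsWithin_mono _ ball_subset_closedBall)
  have ulow : ∀ z ∈ D1, 1 ≤ C * ‖u z‖ := by
    intro z hz
    have := hC _ (h.maps z hz)
    rw [h.inv1 z hz, norm_inv] at this
    have hp := norm_pos_iff.2 (hne z hz)
    rwa [inv_le_iff_one_le_mul₀ hp] at this
  have unz : ∀ c : ℂ, ‖c‖ = 1 → u c ≠ 0 := by
    intro c hc h0
    have := neBot_D1 hc
    have := ge_of_tendsto ((tu c hc).norm.const_mul (C:ℝ)) 
      (eventually_mem_nhdsWithin.mono fun z hz => ulow z hz)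
    simp [h0] at this
    linarith
  have tv : ∀ c : ℂ, ‖c‖ = 1 → ContinuousAt ψ c → ψ c = c →
      Tendsto (fun z => ‖(u (ψ z))⁻¹‖) (𝓝[D1] c) (𝓝 (‖u c‖⁻¹)) := by
    intro c hc hψ hfix
    have ht : Tendsto ψ (𝓝[D1] c) (𝓝[D1] c) := by
      apply tendsto_nhdsWithin_of_tendsto_nhds_of_eventually_within
      · have := hψ.tendsto
        rw [hfix] at this
        exact this.mono_left nhdsWithin_le_nhds
      · exact eventually_mem_nhdsWithin.mono fun z hz => h.maps' z hz
    have := (((tu c hc).comp ht).inv₀ (unz c hc)).norm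
    simpa using this
  have pa := norm_pos_iff.2 (unz a na)
  have pb := norm_pos_iff.2 (unz b nb)
  have up : ∀ ρ : ℝ≥0, max ‖u a‖ ‖u b‖ < ρ → ∃ K : ℝ≥0, ∀ (n : ℕ) f, InD f →
      QD ((wco u φ)^[n] f) ≤ K * ρ ^ n * QD f := by
    intro ρ hρ
    have h1 := (le_max_left _ _).trans_lt hρ
    have h2 := (le_max_right _ _).trans_lt hρ
    exact h.upper2 hu.2 hB' (tu a na).norm (tu b nb).norm hT (NNReal.coe_pos.1 (pa.trans h1)) h1 h2
  have hTn : ∀ (n : ℕ) f, InD f → InD ((wco u φ)^[n] f) := by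
    intro n f hf
    induction n with
    | zero => exact hf
    | succ n ih => rw [Function.iterate_succ_apply']; exact hT.inD ih
  have upD : ∀ ρ : ℝ, max ‖u a‖ ‖u b‖ < ρ → ∃ K : ℝ, 0 ≤ K ∧ ∀ (n : ℕ) f, InDirichlet f →
      dirichletNorm ((wco u φ)^[n] f) ≤ K * ρ ^ n * dirichletNorm f := by
    intro ρ hρ
    have hρ0 : 0 ≤ ρ := (pa.le.trans (le_max_left _ _)).trans hρ.le
    lift ρ to ℝ≥0 using hρ0
    obtain ⟨K, hK⟩ := up ρ hρ
    refine ⟨3 * K, by positivity, fun n f hf => ?_⟩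
    rw [inD_iff] at hf
    have := dnorm_of_QD hf (hTn n f hf) (K := K * ρ ^ n) (by simpa using hK n f hf)
    refine this.trans (le_of_eq ?_)
    push_cast; ring
  constructor
  · obtain ⟨K, hK0, hK⟩ := h.lower hu.2 hT
    apply root_lim (lt_max_of_lt_left pa) hK0
    · intro n
      exact Real.sInf_nonneg fun x hx => hx.1
    · intro n
      obtain ⟨K', hK'0, hK'⟩ := upD (max ‖u a‖ ‖u b‖ + 1) (by linarith)
      rw [← div_le_iff₀' (by positivity)]
      apply le_csInf
      · exact ⟨_, by positivity, hK' n⟩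
      · rintro x ⟨hx0, hx⟩
        rw [div_le_iff₀' (by positivity)]
        rcases max_choice ‖u a‖ ‖u b‖ with e | e <;> rw [e]
        · exact hK a na (tu a na) cφa φa n x hx0 hx
        · exact hK b nb (tu b nb) cφb φb n x hx0 hx
    · intro ρ hρ
      obtain ⟨K', hK'0, hK'⟩ := upD ρ hρ
      have hρ0 : 0 ≤ ρ := (pa.le.trans (le_max_left _ _)).trans (le_of_lt hρ)
      refine ⟨K', fun n => csInf_le ⟨0, fun x hx => hx.1⟩ ⟨by positivity, hK' n⟩⟩
  · intro lam hlam
    constructor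
    · by_contra hcon
      rw [not_le] at hcon
      apply hlam
      have hm : 0 < min ‖u a‖ ‖u b‖ := lt_min pa pb
      obtain ⟨s, hs1, hs2⟩ := exists_between hcon
      have hs0 : 0 < s := (norm_nonneg _).trans_lt hs1
      have i1 : ‖u a‖⁻¹ < s⁻¹ := inv_strictAnti₀ hs0 (hs2.trans_le (min_le_left _ _))
      have i2 : ‖u b‖⁻¹ < s⁻¹ := inv_strictAnti₀ hs0 (hs2.trans_le (min_le_right _ _))
      lift s to ℝ≥0 using hs0.le
      have hs0' : 0 < s := by exact_mod_cast hs0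
      obtain ⟨K, hK⟩ := h.symm.upper2 han hC (tv b nb cψb ψb) (tv a na cψa ψa) hR (ρ := s⁻¹)
        (by positivity) (by push_cast; exact i2) (by push_cast; exact i1)
      refine h.inv_small han hT hR (fun z hz => ?_) hK ?_
      · rw [h.inv1 z hz]; exact mul_inv_cancel₀ (hne z hz)
      · rw [← div_eq_mul_inv, div_lt_one hs0']; exact_mod_cast hs1
    · by_contra hcon
      rw [not_le] at hcon
      apply hlam
      obtain ⟨s, hs1, hs2⟩ := exists_between hcon
      have hs0 : 0 < s := (pa.trans_le (le_max_left _ _)).trans hs1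
      lift s to ℝ≥0 using hs0.le
      obtain ⟨K, hK⟩ := up s hs1
      exact h.inv_large hu.2 hT hK (by exact_mod_cast hs2)

end Helpers

/-- hyperbolic case on the Dirichlet space: spectral radius and annulus. -/
theorem stmt_19 (u φ : ℂ → ℂ) (a b : ℂ) (hu : InDiscAlgebra u)
    (hh : IsHyperbolicAuto φ a b) (hinv : InvertibleOnDirichlet (wco u φ)) :
    Filter.Tendsto (fun n : ℕ => opNormDir ((wco u φ)^[n]) ^ ((1 : ℝ) / n))
        Filter.atTop (nhds (max ‖u a‖ ‖u b‖)) ∧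
      dirichletSpectrum (wco u φ) ⊆
        {lam : ℂ | min ‖u a‖ ‖u b‖ ≤ ‖lam‖ ∧ ‖lam‖ ≤ max ‖u a‖ ‖u b‖} := by
  exact main_thm u φ a b hu hh hinv
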